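/- arXiv:2510.07250 — 2 statements merged into one kernel-verified Lean document; each statement's English description precedes it below -/
import Mathlib

section
/- Consider the Gaussian link target with link f satisfying Assumption 3 with constants (C_f, C̃_f), a parameter set Θ ⊆ ℝ with sup_{θ∈Θ} θ² < ∞, and the Markov kernel T*_N built from the truncated signed kernel with σ = 1. There exists a universal constant C > 0 such that: if 2N+1 ≥ C̄_f and τ² ≥ C·max( (max(C̃_f,1))⁴·(max(L_f(2N), L̃_f(2N,τ), 1))²·N², sup_{θ∈Θ} θ² ), then for every θ ∈ Θ, (1/2)·∫_ℝ |∫_ℝ T*_N(y|x)·u(x;θ) dx − v(y;θ)| dy ≤ C̄_f·exp(−(2N+1)^{1/(2(1+C_f))}/(2e)) + 12·e^{−τ/8} + 15·sup_{θ'∈Θ} exp(θ'²/2 − τ²/8). -/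
open MeasureTheory Real Filter

/-- The Gaussian source density `u(x;θ)` with standard deviation `σ`. -/
noncomputable def srcDensity (σ θ x : ℝ) : ℝ :=
  (1 / (Real.sqrt (2 * Real.pi) * σ)) * Real.exp (-(x - θ)^2 / (2 * σ^2))

/-- The Gaussian link target density `v(y;θ) = (1/√(2π))·exp(−(y − f(θ/τ))²/2)`. -/
noncomputable def linkDensity (f : ℝ → ℝ) (τ y θ : ℝ) : ℝ :=
  (1 / Real.sqrt (2 * Real.pi)) * Real.exp (-(y - f (θ/τ))^2 / 2)

/-- The weighted derivative sum `Σ_{j=1}^{n} |f^{(j)}(t)|/(C̃^j·j!)`. -/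
noncomputable def derivSumF (f : ℝ → ℝ) (Ct : ℝ) (n : ℕ) (t : ℝ) : ℝ :=
  ∑ j ∈ Finset.Icc 1 n, |iteratedDeriv j f t| / (Ct^j * (Nat.factorial j : ℝ))

/-- Assumption 3 on the link function `f` with constants `(Cf, C̃f)`. -/
structure Assumption3 (f : ℝ → ℝ) (Cf : ℕ) (Ct : ℝ) : Prop where
  Ct_pos : 0 < Ct
  smooth : ContDiff ℝ (⊤ : ℕ∞) f
  bound_int : ∀ (θ : ℝ) (n : ℕ), 1 ≤ n → ∀ τ : ℝ, 2 * Real.sqrt 2 * max 1 |θ| ≤ τ →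
    Integrable (fun x : ℝ =>
      (derivSumF f Ct n ((θ + Real.sqrt 2 * x)/τ))^n *
        (Real.exp (-x^2/2) / Real.sqrt (2 * Real.pi)))
  bound_le : ∀ (θ : ℝ) (n : ℕ), 1 ≤ n → ∀ τ : ℝ, 2 * Real.sqrt 2 * max 1 |θ| ≤ τ →
    ∫ x : ℝ,
      (derivSumF f Ct n ((θ + Real.sqrt 2 * x)/τ))^n *
        (Real.exp (-x^2/2) / Real.sqrt (2 * Real.pi))
      ≤ (Nat.factorial (Cf * n) : ℝ)

/-- `C̄f = 32π²·(2e)^{4(1+Cf)}·e^{4(1+Cf)²}`. -/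
noncomputable def CbarF (Cf : ℕ) : ℝ :=
  32 * Real.pi^2 * (2 * Real.exp 1)^(4*(1+Cf)) * (Real.exp 1)^(4*(1+Cf)^2)

/-- `L_f(n) = sup_{|x|≤1} Σ_{j=1}^{n} |f^{(j)}(x)|/(C̃f^j·j!)`. -/
noncomputable def Lf (f : ℝ → ℝ) (Ct : ℝ) (n : ℕ) : ℝ :=
  ⨆ x ∈ {x : ℝ | |x| ≤ 1}, derivSumF f Ct n x

/-- `L̃_f(n,τ) = sup_{|x|≥1} (Σ_{j=1}^{n} |f^{(j)}(x)|/(C̃f^j·j!))·exp(−τ²x²/(8n))`. -/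
noncomputable def Ltf (f : ℝ → ℝ) (Ct : ℝ) (n : ℕ) (τ : ℝ) : ℝ :=
  ⨆ x ∈ {x : ℝ | 1 ≤ |x|},
    derivSumF f Ct n x * Real.exp (-(τ^2 * x^2) / (8*(n:ℝ)))

/-- The truncated signed kernel `S*_N(y|x)` (with `σ = 1`). -/
noncomputable def signedKernel (σ : ℝ) (v : ℝ → ℝ → ℝ) (N : ℕ) (y x : ℝ) : ℝ :=
  ∑ k ∈ Finset.range (N + 1),
    ((-1 : ℝ)^k * σ^(2*k) / ((2:ℝ)^k * (Nat.factorial k : ℝ))) *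
      iteratedDeriv (2*k) (fun θ => v y θ) x

/-- `p(x) = ∫ max(S*_N(y|x), 0) dy`. -/
noncomputable def pFun (σ : ℝ) (v : ℝ → ℝ → ℝ) (N : ℕ) (x : ℝ) : ℝ :=
  ∫ y : ℝ, max (signedKernel σ v N y x) 0

/-- `q(x) = −∫ min(S*_N(y|x), 0) dy`. -/
noncomputable def qFun (σ : ℝ) (v : ℝ → ℝ → ℝ) (N : ℕ) (x : ℝ) : ℝ :=
  - ∫ y : ℝ, min (signedKernel σ v N y x) 0

/-- The Markov kernel `T*_N(y|x) = max(S*_N(y|x), 0)/p(x)`. -/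
noncomputable def markovKernel (σ : ℝ) (v : ℝ → ℝ → ℝ) (N : ℕ) (y x : ℝ) : ℝ :=
  max (signedKernel σ v N y x) 0 / pFun σ v N x

/-- The weighted `ℓ¹` norm of the `n`-jet of `g` at `x`. -/
noncomputable def jetNorm (g : ℝ → ℝ) (x r : ℝ) (n : ℕ) : ℝ :=
  ∑ j ∈ Finset.range (n + 1), |iteratedDeriv j g x| / (Nat.factorial j : ℝ) * r ^ j

lemma sum_antidiagonal_le_mul_sum {u v : ℕ → ℝ} (hu : ∀ i, 0 ≤ u i) (hv : ∀ i, 0 ≤ v i) (n : ℕ) :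
    ∑ m ∈ Finset.range n, ∑ p ∈ Finset.HasAntidiagonal.antidiagonal m, u p.1 * v p.2 ≤
      (∑ i ∈ Finset.range n, u i) * ∑ j ∈ Finset.range n, v j := by
  rw [Finset.sum_mul_sum, ← Finset.sum_product',
    ← Finset.sum_sigma (Finset.range n) (fun m => Finset.HasAntidiagonal.antidiagonal m)
      (fun q => u q.2.1 * v q.2.2)]
  have himg := Finset.sum_image (f := fun p : ℕ × ℕ => u p.1 * v p.2)
    (s := (Finset.range n).sigma fun m => Finset.HasAntidiagonal.antidiagonal m)
    (g := fun q => q.2) ?_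
  · rw [← himg]
    refine Finset.sum_le_sum_of_subset_of_nonneg ?_ fun p _ _ => mul_nonneg (hu _) (hv _)
    intro p hp
    simp only [Finset.mem_image, Finset.mem_sigma, Finset.mem_range,
      Finset.HasAntidiagonal.mem_antidiagonal, Finset.mem_product] at hp ⊢
    obtain ⟨q, hq, rfl⟩ := hp
    omega
  · rintro ⟨a, p⟩ ha ⟨b, q⟩ hb h
    simp only [Finset.coe_sigma, Set.mem_sigma_iff, Finset.mem_coe, Finset.mem_range,
      Finset.HasAntidiagonal.mem_antidiagonal] at ha hb h
    subst h
    obtain ⟨_, rfl⟩ := ha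
    obtain ⟨_, rfl⟩ := hb
    rfl

lemma iteratedDeriv_mul_div_factorial {g h : ℝ → ℝ} (hg : ContDiff ℝ (⊤ : ℕ∞) g)
    (hh : ContDiff ℝ (⊤ : ℕ∞) h) (x : ℝ) (n : ℕ) :
    iteratedDeriv n (g * h) x / (Nat.factorial n : ℝ) =
      ∑ p ∈ Finset.HasAntidiagonal.antidiagonal n, (iteratedDeriv p.1 g x / (Nat.factorial p.1 : ℝ)) *
        (iteratedDeriv p.2 h x / (Nat.factorial p.2 : ℝ)) := by
  have hn : ((n : ℕ) : WithTop ℕ∞) ≤ ((⊤ : ℕ∞) : WithTop ℕ∞) := by exact_mod_cast le_top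
  rw [iteratedDeriv_mul (hg.contDiffAt.of_le hn) (hh.contDiffAt.of_le hn),
    Finset.Nat.sum_antidiagonal_eq_sum_range_succ
      (fun i j => (iteratedDeriv i g x / (Nat.factorial i : ℝ)) *
        (iteratedDeriv j h x / (Nat.factorial j : ℝ))), Finset.sum_div]
  refine Finset.sum_congr rfl fun i hi => ?_
  have hi' : i ≤ n := Nat.lt_succ_iff.mp (Finset.mem_range.mp hi)
  rw [Nat.cast_choose ℝ hi']
  have h1 := Nat.factorial_ne_zero n
  have h2 := Nat.factorial_ne_zero i
  have h3 := Nat.factorial_ne_zero (n - i)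
  field_simp

lemma jetNorm_nonneg (g : ℝ → ℝ) (x : ℝ) {r : ℝ} (hr : 0 ≤ r) (n : ℕ) : 0 ≤ jetNorm g x r n :=
  Finset.sum_nonneg fun _ _ => by positivity

lemma jetNorm_mul_le {g h : ℝ → ℝ} (hg : ContDiff ℝ (⊤ : ℕ∞) g)
    (hh : ContDiff ℝ (⊤ : ℕ∞) h) (x : ℝ) {r : ℝ} (hr : 0 ≤ r) (n : ℕ) :
    jetNorm (g * h) x r n ≤ jetNorm g x r n * jetNorm h x r n := by
  refine le_trans ?_ (sum_antidiagonal_le_mul_sum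
    (u := fun j => |iteratedDeriv j g x| / (Nat.factorial j : ℝ) * r ^ j)
    (v := fun j => |iteratedDeriv j h x| / (Nat.factorial j : ℝ) * r ^ j)
    (fun _ => by positivity) (fun _ => by positivity) (n + 1))
  refine Finset.sum_le_sum fun m _ => ?_
  rw [← Nat.abs_cast (Nat.factorial m), ← abs_div, iteratedDeriv_mul_div_factorial hg hh]
  calc _ ≤ (∑ p ∈ Finset.HasAntidiagonal.antidiagonal m, |(iteratedDeriv p.1 g x / (Nat.factorial p.1 : ℝ)) *
        (iteratedDeriv p.2 h x / (Nat.factorial p.2 : ℝ))|) * r ^ m := by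
        gcongr
        exact Finset.abs_sum_le_sum_abs _ _
    _ = _ := by
        rw [Finset.sum_mul]
        refine Finset.sum_congr rfl fun p hp => ?_
        rw [← Finset.HasAntidiagonal.mem_antidiagonal.mp hp, abs_mul, abs_div, abs_div, Nat.abs_cast,
          Nat.abs_cast, pow_add]
        ring

lemma jetNorm_add_le {g h : ℝ → ℝ} (hg : ContDiff ℝ (⊤ : ℕ∞) g)
    (hh : ContDiff ℝ (⊤ : ℕ∞) h) (x : ℝ) {r : ℝ} (hr : 0 ≤ r) (n : ℕ) :
    jetNorm (g + h) x r n ≤ jetNorm g x r n + jetNorm h x r n := by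
  unfold jetNorm
  rw [← Finset.sum_add_distrib]
  refine Finset.sum_le_sum fun m _ => ?_
  have hn : ((m : ℕ) : WithTop ℕ∞) ≤ ((⊤ : ℕ∞) : WithTop ℕ∞) := by exact_mod_cast le_top
  rw [iteratedDeriv_add (hg.contDiffAt.of_le hn) (hh.contDiffAt.of_le hn), ← add_mul, ← add_div]
  gcongr
  exact abs_add_le _ _

lemma jetNorm_const_mul (c : ℝ) (g : ℝ → ℝ) (x r : ℝ) (n : ℕ) :
    jetNorm (fun t => c * g t) x r n = |c| * jetNorm g x r n := by
  unfold jetNorm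
  rw [Finset.mul_sum]
  refine Finset.sum_congr rfl fun m _ => ?_
  rw [iteratedDeriv_const_mul_field, abs_mul]
  ring

/-- A Grönwall-type comparison for the recursion satisfied by the Taylor coefficients of `exp ∘ g`. -/
lemma sum_mul_pow_le_exp_of_recursion {a w : ℕ → ℝ} (ha : ∀ i, 0 ≤ a i) (hw : ∀ i, 0 ≤ w i)
    (h0 : w 0 ≤ Real.exp (a 0))
    (hrec : ∀ m : ℕ, ((m : ℝ) + 1) * w (m + 1) ≤
      ∑ p ∈ Finset.HasAntidiagonal.antidiagonal m, (((p.1 : ℝ) + 1) * a (p.1 + 1)) * w p.2)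
    (n : ℕ) {r : ℝ} (hr : 0 ≤ r) :
    ∑ j ∈ Finset.range (n + 1), w j * r ^ j ≤
      Real.exp (∑ j ∈ Finset.range (n + 1), a j * r ^ j) := by
  set A : ℝ → ℝ := fun r => ∑ j ∈ Finset.range (n + 1), a j * r ^ j with hA
  set B : ℝ → ℝ := fun r => ∑ j ∈ Finset.range (n + 1), w j * r ^ j with hB
  have hder : ∀ (u : ℕ → ℝ) (r : ℝ), HasDerivAt
      (fun r => ∑ j ∈ Finset.range (n + 1), u j * r ^ j)
      (∑ j ∈ Finset.range n, ((j : ℝ) + 1) * u (j + 1) * r ^ j) r := by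
    intro u r
    have h1 : HasDerivAt (fun r : ℝ => ∑ j ∈ Finset.range (n + 1), u j * r ^ j)
        (∑ j ∈ Finset.range (n + 1), u j * (j * r ^ (j - 1))) r :=
      HasDerivAt.fun_sum fun j _ => (hasDerivAt_pow j r).const_mul _
    convert h1 using 1
    rw [Finset.sum_range_succ']
    simp only [Nat.cast_add, Nat.cast_one, Nat.add_sub_cancel, Nat.cast_zero, zero_mul, mul_zero,
      add_zero]
    exact Finset.sum_congr rfl fun j _ => by ring
  have hAd := hder a
  have hBd := hder w
  have hanti : AntitoneOn (fun r => B r * Real.exp (-A r)) (Set.Ici 0) := by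
    have hd : ∀ r, HasDerivAt (fun r => B r * Real.exp (-A r))
        ((∑ j ∈ Finset.range n, ((j : ℝ) + 1) * w (j + 1) * r ^ j) * Real.exp (-A r) +
          B r * (Real.exp (-A r) *
            (-(∑ j ∈ Finset.range n, ((j : ℝ) + 1) * a (j + 1) * r ^ j)))) r :=
      fun r => (hBd r).mul ((hAd r).neg.exp)
    refine antitoneOn_of_deriv_nonpos (convex_Ici 0)
      (fun r _ => (hd r).continuousAt.continuousWithinAt)
      (fun r _ => (hd r).differentiableAt.differentiableWithinAt) ?_
    intro r hr
    have hr0 : 0 ≤ r := by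
      simp only [interior_Ici, Set.mem_Ioi] at hr
      exact hr.le
    rw [(hd r).deriv]
    have key : ∑ j ∈ Finset.range n, ((j : ℝ) + 1) * w (j + 1) * r ^ j ≤
        (∑ j ∈ Finset.range n, ((j : ℝ) + 1) * a (j + 1) * r ^ j) * B r := by
      calc _ ≤ ∑ m ∈ Finset.range n, ∑ p ∈ Finset.HasAntidiagonal.antidiagonal m,
            (((p.1 : ℝ) + 1) * a (p.1 + 1) * r ^ p.1) * (w p.2 * r ^ p.2) := by
            refine Finset.sum_le_sum fun m _ => ?_
            calc _ ≤ (∑ p ∈ Finset.HasAntidiagonal.antidiagonal m,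
                  (((p.1 : ℝ) + 1) * a (p.1 + 1)) * w p.2) * r ^ m := by
                  gcongr
                  exact hrec m
              _ = _ := by
                  rw [Finset.sum_mul]
                  refine Finset.sum_congr rfl fun p hp => ?_
                  rw [← Finset.HasAntidiagonal.mem_antidiagonal.mp hp, pow_add]
                  ring
        _ ≤ (∑ j ∈ Finset.range n, ((j : ℝ) + 1) * a (j + 1) * r ^ j) *
            ∑ j ∈ Finset.range n, w j * r ^ j :=
            sum_antidiagonal_le_mul_sum
              (u := fun j => ((j : ℝ) + 1) * a (j + 1) * r ^ j) (v := fun j => w j * r ^ j)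
              (fun i => mul_nonneg (mul_nonneg (by positivity) (ha _)) (by positivity))
              (fun i => mul_nonneg (hw _) (by positivity)) n
        _ ≤ _ := by
            refine mul_le_mul_of_nonneg_left ?_ (Finset.sum_nonneg fun i _ =>
              mul_nonneg (mul_nonneg (by positivity) (ha _)) (by positivity))
            simp only [hB, Finset.sum_range_succ _ n]
            exact le_add_of_nonneg_right (mul_nonneg (hw _) (by positivity))
    have he := Real.exp_pos (-A r)
    nlinarith
  have h := hanti (Set.mem_Ici.mpr le_rfl) (Set.mem_Ici.mpr hr) hr
  have hA0 : A 0 = a 0 := by simp [hA, Finset.sum_range_succ']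
  have hB0 : B 0 = w 0 := by simp [hB, Finset.sum_range_succ']
  simp only [hA0, hB0] at h
  have h2 : B r * Real.exp (-A r) ≤ 1 := h.trans (by
    rw [Real.exp_neg, ← div_eq_mul_inv]
    exact (div_le_one (Real.exp_pos _)).mpr h0)
  rw [Real.exp_neg, ← div_eq_mul_inv] at h2
  exact (div_le_one (Real.exp_pos _)).mp h2

lemma jetNorm_exp_le {g : ℝ → ℝ} (hg : ContDiff ℝ (⊤ : ℕ∞) g) (x : ℝ) {r : ℝ} (hr : 0 ≤ r)
    (n : ℕ) : jetNorm (fun t => Real.exp (g t)) x r n ≤ Real.exp (jetNorm g x r n) := by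
  refine sum_mul_pow_le_exp_of_recursion
    (a := fun j => |iteratedDeriv j g x| / (Nat.factorial j : ℝ))
    (w := fun j => |iteratedDeriv j (fun t => Real.exp (g t)) x| / (Nat.factorial j : ℝ))
    (fun _ => by positivity) (fun _ => by positivity) ?_ ?_ n hr
  · simpa using le_abs_self _
  intro m
  have hg' : ContDiff ℝ (⊤ : ℕ∞) (deriv g) := by
    have := (contDiff_infty_iff_deriv ).mp hg
    exact this.2
  have hd : deriv (fun t => Real.exp (g t)) = deriv g * fun t => Real.exp (g t) := by
    ext t
    have := (hg.differentiable (by simp)).differentiableAt (x := t) |>.hasDerivAt.exp.deriv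
    rw [this, Pi.mul_apply, mul_comm]
  have hsucc : ∀ (u : ℝ → ℝ) (j : ℕ), ((j : ℝ) + 1) *
      (|iteratedDeriv (j + 1) u x| / (Nat.factorial (j + 1) : ℝ)) =
      |iteratedDeriv j (deriv u) x / (Nat.factorial j : ℝ)| := by
    intro u j
    rw [iteratedDeriv_succ', abs_div, Nat.abs_cast, Nat.factorial_succ]
    push_cast
    field_simp
  simp only [hsucc]
  rw [hd, iteratedDeriv_mul_div_factorial hg' hg.exp]
  refine (Finset.abs_sum_le_sum_abs _ _).trans (Finset.sum_le_sum fun p _ => ?_)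
  rw [abs_mul, abs_div (iteratedDeriv p.2 _ x), Nat.abs_cast]

lemma jetNorm_comp_div_sub_const_le {f : ℝ → ℝ} (hf : ContDiff ℝ (⊤ : ℕ∞) f) {Ct τ : ℝ}
    (hCt : 0 < Ct) (hτ : 0 < τ) {n : ℕ} {x Q : ℝ} (hQ : 1 ≤ Q) :
    jetNorm (fun θ => f (θ / τ) - f (x / τ)) x (τ / (Ct * Q)) n ≤
      derivSumF f Ct n (x / τ) / Q := by
  have hQ0 : 0 < Q := by linarith
  unfold jetNorm derivSumF
  rw [Finset.sum_range_succ', Finset.sum_div,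
    Finset.range_eq_Ico, Finset.sum_Ico_add' (fun j =>
      |iteratedDeriv j (fun θ => f (θ / τ) - f (x / τ)) x| / (Nat.factorial j : ℝ) *
        (τ / (Ct * Q)) ^ j) 0 n 1]
  simp only [iteratedDeriv_zero, sub_self, abs_zero, zero_div, zero_mul, add_zero, zero_add]
  rw [show Finset.Ico 1 (n + 1) = Finset.Icc 1 n from rfl]
  refine Finset.sum_le_sum fun j hj => ?_
  have hj1 : 1 ≤ j := (Finset.mem_Icc.mp hj).1
  have hder : iteratedDeriv j (fun θ => f (θ / τ) - f (x / τ)) x =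
      (1 / τ) ^ j * iteratedDeriv j f (x / τ) := by
    have hn : ((j : ℕ) : WithTop ℕ∞) ≤ ((⊤ : ℕ∞) : WithTop ℕ∞) := by exact_mod_cast le_top
    have h1 : iteratedDeriv j (fun θ => f (θ / τ) - f (x / τ)) x =
        iteratedDeriv j (fun θ => f (1 / τ * θ)) x := by
      obtain ⟨i, rfl⟩ : ∃ i, j = i + 1 := ⟨j - 1, by omega⟩
      rw [iteratedDeriv_succ', iteratedDeriv_succ']
      congr 1
      ext t
      rw [deriv_sub_const]
      congr 1
      ext u
      congr 1
      ring
    rw [h1, iteratedDeriv_comp_const_mul (hf.of_le hn)]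
    simp only
    congr 2
    ring
  have hpow : Q ≤ Q ^ j := le_self_pow₀ hQ (by omega)
  rw [hder, abs_mul, abs_of_nonneg (by positivity : (0 : ℝ) ≤ (1 / τ) ^ j)]
  calc (1 / τ) ^ j * |iteratedDeriv j f (x / τ)| / (Nat.factorial j : ℝ) * (τ / (Ct * Q)) ^ j
      = |iteratedDeriv j f (x / τ)| / (Ct ^ j * (Nat.factorial j : ℝ)) / Q ^ j := by
        rw [div_pow, div_pow, mul_pow, one_pow]
        field_simp
    _ ≤ _ := by gcongr

lemma contDiff_linkDensity {f : ℝ → ℝ} (hf : ContDiff ℝ (⊤ : ℕ∞) f) (τ : ℝ) :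
    ContDiff ℝ (⊤ : ℕ∞) (fun p : ℝ × ℝ => linkDensity f τ p.1 p.2) := by
  unfold linkDensity
  have : ContDiff ℝ (⊤ : ℕ∞) (fun p : ℝ × ℝ => f (p.2 / τ)) := hf.comp (contDiff_snd.div_const τ)
  exact contDiff_const.mul ((((contDiff_fst.sub this).pow 2).neg.div_const 2).exp)

lemma abs_iteratedDeriv_linkDensity_le {f : ℝ → ℝ} (hf : ContDiff ℝ (⊤ : ℕ∞) f) {Ct τ : ℝ}
    (hCt : 0 < Ct) (hτ : 0 < τ) {n : ℕ} {x y D R : ℝ} (hD : 1 ≤ D) (hR : 1 ≤ R)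
    (hder : derivSumF f Ct n (x / τ) ≤ D) :
    |iteratedDeriv n (fun θ => linkDensity f τ y θ) x| ≤
      (Nat.factorial n : ℝ) * (Ct * (D * R) / τ) ^ n * (1 / Real.sqrt (2 * Real.pi)) *
        Real.exp (-(y - f (x / τ)) ^ 2 / 2 + |y - f (x / τ)| / R + 1 / 2) := by
  set z := y - f (x / τ) with hz
  set k : ℝ → ℝ := fun θ => f (θ / τ) - f (x / τ) with hk
  set r := τ / (Ct * (D * R)) with hr
  have hDR : 1 ≤ D * R := one_le_mul_of_one_le_of_one_le hD hR
  have hr0 : 0 < r := by positivity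
  have hkc : ContDiff ℝ (⊤ : ℕ∞) k := (hf.comp (contDiff_id.div_const τ)).sub contDiff_const
  set H := jetNorm k x r n with hHdef
  have hH : H ≤ 1 / R := by
    refine (jetNorm_comp_div_sub_const_le hf hCt hτ hDR).trans ?_
    rw [div_le_div_iff₀ (by positivity) (by positivity)]
    nlinarith
  have hH0 : 0 ≤ H := jetNorm_nonneg k x hr0.le n
  set c0 := (1 / Real.sqrt (2 * Real.pi)) * Real.exp (-z ^ 2 / 2) with hc0
  have hc0pos : 0 < c0 := by positivity
  set g : ℝ → ℝ := (fun θ => z * k θ) + fun θ => (-1 / 2) * (k * k) θ with hg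
  have hg1 : ContDiff ℝ (⊤ : ℕ∞) (fun θ => z * k θ) := contDiff_const.mul hkc
  have hg2 : ContDiff ℝ (⊤ : ℕ∞) (fun θ => (-1 / 2) * (k * k) θ) :=
    contDiff_const.mul (hkc.mul hkc)
  have hgc : ContDiff ℝ (⊤ : ℕ∞) g := hg1.add hg2
  have hfac : (fun θ => linkDensity f τ y θ) = fun θ => c0 * Real.exp (g θ) := by
    ext θ
    simp only [linkDensity, hc0, hg, hk, Pi.add_apply, Pi.mul_apply]
    rw [mul_assoc, ← Real.exp_add]
    congr 2
    rw [hz]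
    ring
  have hgn : jetNorm g x r n ≤ |z| / R + 1 / 2 := by
    calc jetNorm g x r n ≤ |z| * H + |(-1 / 2 : ℝ)| * (H * H) := by
          refine (jetNorm_add_le hg1 hg2 x hr0.le n).trans ?_
          rw [jetNorm_const_mul, jetNorm_const_mul]
          gcongr
          exact jetNorm_mul_le hkc hkc x hr0.le n
      _ ≤ |z| * (1 / R) + 1 / 2 * (1 * 1) := by
          have h1 : H ≤ 1 := hH.trans ((div_le_one (by linarith)).mpr hR)
          rw [show |(-1 / 2 : ℝ)| = 1 / 2 by norm_num [abs_of_neg]]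
          gcongr
      _ = _ := by ring
  have hterm : |iteratedDeriv n (fun t => Real.exp (g t)) x| / (Nat.factorial n : ℝ) * r ^ n ≤
      Real.exp (|z| / R + 1 / 2) := by
    refine le_trans ?_ ((jetNorm_exp_le hgc x hr0.le n).trans (Real.exp_le_exp.mpr hgn))
    exact Finset.single_le_sum
      (f := fun j => |iteratedDeriv j (fun t => Real.exp (g t)) x| / (Nat.factorial j : ℝ) * r ^ j)
      (fun _ _ => by positivity) (Finset.mem_range.mpr (Nat.lt_succ_self n))
  rw [hfac, iteratedDeriv_const_mul_field, abs_mul, abs_of_pos hc0pos, add_assoc, Real.exp_add]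
  have hinv : Ct * (D * R) / τ = r⁻¹ := by rw [hr, inv_div]
  rw [hinv, inv_pow]
  have hn0 : (0 : ℝ) < Nat.factorial n := by positivity
  have hrn : 0 < r ^ n := by positivity
  have h3 : |iteratedDeriv n (fun t => Real.exp (g t)) x| ≤
      (Nat.factorial n : ℝ) * (r ^ n)⁻¹ * Real.exp (|z| / R + 1 / 2) := by
    rw [div_mul_eq_mul_div, div_le_iff₀ hn0] at hterm
    rw [← div_eq_mul_inv, div_mul_eq_mul_div, le_div_iff₀ hrn]
    linarith
  calc c0 * |iteratedDeriv n (fun t => Real.exp (g t)) x| ≤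
      c0 * ((Nat.factorial n : ℝ) * (r ^ n)⁻¹ * Real.exp (|z| / R + 1 / 2)) := by gcongr
    _ = _ := by rw [hc0]; ring

lemma contDiff_iteratedDeriv_snd {F : ℝ → ℝ → ℝ}
    (hF : ContDiff ℝ (⊤ : ℕ∞) (fun p : ℝ × ℝ => F p.1 p.2)) (n : ℕ) :
    ContDiff ℝ (⊤ : ℕ∞) (fun p : ℝ × ℝ => iteratedDeriv n (F p.1) p.2) := by
  induction n with
  | zero => simpa using hF
  | succ n ih =>
    have h : (fun p : ℝ × ℝ => iteratedDeriv (n + 1) (F p.1) p.2) =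
        fun p => fderiv ℝ (fun p : ℝ × ℝ => iteratedDeriv n (F p.1) p.2) p (0, 1) := by
      ext ⟨y, x⟩
      rw [iteratedDeriv_succ]
      have h1 : HasFDerivAt (fun p : ℝ × ℝ => iteratedDeriv n (F p.1) p.2) _ (y, x) :=
        (ih.differentiable (by simp) (y, x)).hasFDerivAt
      have h2 : HasDerivAt (fun t : ℝ => (y, t)) ((0 : ℝ), (1 : ℝ)) x :=
        (hasDerivAt_const x y).prodMk (hasDerivAt_id x)
      exact (h1.comp_hasDerivAt x h2).deriv
    rw [h]
    exact (ih.fderiv_right (by simp)).clm_apply contDiff_const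

lemma hasDerivAt_iteratedDeriv {g : ℝ → ℝ} (hg : ContDiff ℝ (⊤ : ℕ∞) g) (n : ℕ) (x : ℝ) :
    HasDerivAt (iteratedDeriv n g) (iteratedDeriv (n + 1) g x) x := by
  rw [iteratedDeriv_succ]
  exact (hg.differentiable_iteratedDeriv n (by exact_mod_cast ENat.natCast_lt_top n) x).hasDerivAt

/-- The standard Gaussian density. -/
noncomputable def stdGauss (x : ℝ) : ℝ := (1 / Real.sqrt (2 * Real.pi)) * Real.exp (-x ^ 2 / 2)

lemma continuous_stdGauss : Continuous stdGauss := by unfold stdGauss; fun_prop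

lemma stdGauss_pos (x : ℝ) : 0 < stdGauss x := by unfold stdGauss; positivity

lemma one_div_sqrt_two_pi_le_one : 1 / Real.sqrt (2 * Real.pi) ≤ 1 := by
  rw [div_le_one (by positivity)]
  exact Real.one_le_sqrt.mpr (by nlinarith [Real.pi_gt_three])

lemma hasDerivAt_stdGauss (x : ℝ) : HasDerivAt stdGauss (-x * stdGauss x) x := by
  unfold stdGauss
  have h : HasDerivAt (fun x : ℝ => -x ^ 2 / 2) (-x) x := by
    refine ((hasDerivAt_pow 2 x).neg.div_const 2).congr_deriv ?_
    norm_num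
    ring
  refine (h.exp.const_mul (1 / Real.sqrt (2 * Real.pi))).congr_deriv ?_
  ring

lemma integral_exp_neg_sq_div {b : ℝ} (hb : 0 < b) :
    ∫ x : ℝ, Real.exp (-x ^ 2 / b) = Real.sqrt (b * Real.pi) := by
  have := integral_gaussian (1 / b)
  rw [show Real.pi / (1 / b) = b * Real.pi by field_simp] at this
  rw [← this]
  congr 1
  ext x
  congr 1
  field_simp

lemma integrable_exp_neg_sq_div {b : ℝ} (hb : 0 < b) :
    Integrable (fun x : ℝ => Real.exp (-x ^ 2 / b)) := by
  have := integrable_exp_neg_mul_sq (b := 1 / b) (by positivity)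
  convert this using 2
  field_simp

lemma integrable_stdGauss : Integrable stdGauss :=
  (integrable_exp_neg_sq_div two_pos).const_mul _

lemma integral_stdGauss : ∫ x, stdGauss x = 1 := by
  unfold stdGauss
  rw [integral_const_mul, integral_exp_neg_sq_div two_pos]
  have : Real.sqrt (2 * Real.pi) ≠ 0 := by positivity
  field_simp

lemma exp_mul_stdGauss_le {s θ x : ℝ} (hs : |s| ≤ 11 / 10) :
    Real.exp ((θ + s * x) ^ 2 / 6) * stdGauss x ≤
      Real.exp (θ ^ 2 / 3) * Real.exp (-x ^ 2 / 11) := by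
  have h1 : stdGauss x ≤ Real.exp (-x ^ 2 / 2) :=
    mul_le_of_le_one_left (Real.exp_pos _).le one_div_sqrt_two_pi_le_one
  have hs2 : s ^ 2 ≤ 121 / 100 := by
    rw [← sq_abs]
    nlinarith [abs_nonneg s]
  calc _ ≤ Real.exp ((θ + s * x) ^ 2 / 6) * Real.exp (-x ^ 2 / 2) := by gcongr
    _ = Real.exp ((θ + s * x) ^ 2 / 6 + -x ^ 2 / 2) := by rw [Real.exp_add]
    _ ≤ Real.exp (θ ^ 2 / 3 + -x ^ 2 / 11) := by
        refine Real.exp_le_exp.mpr ?_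
        nlinarith [sq_nonneg (θ - s * x), mul_le_mul_of_nonneg_right hs2 (sq_nonneg x)]
    _ = _ := by rw [Real.exp_add]

/-- A sequence of successive derivatives whose members up to order `m` have Gaussian growth. -/
structure GaussianGrowth (Φ : ℕ → ℝ → ℝ) (m : ℕ) (K : ℝ) : Prop where
  hasDerivAt : ∀ n x, HasDerivAt (Φ n) (Φ (n + 1) x) x
  bound : ∀ n ≤ m, ∀ x, |Φ n x| ≤ K * Real.exp (x ^ 2 / 6)

namespace GaussianGrowth

variable {Φ : ℕ → ℝ → ℝ} {m : ℕ} {K : ℝ}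

lemma continuous (h : GaussianGrowth Φ m K) (n : ℕ) : Continuous (Φ n) :=
  continuous_iff_continuousAt.mpr fun x => (h.hasDerivAt n x).continuousAt

lemma abs_mul_stdGauss_le (h : GaussianGrowth Φ m K) {n : ℕ} (hn : n ≤ m) {s : ℝ}
    (hs : |s| ≤ 11 / 10) (θ x : ℝ) : |Φ n (θ + s * x)| * stdGauss x ≤
      K * Real.exp (θ ^ 2 / 3) * Real.exp (-x ^ 2 / 11) := by
  have hK : 0 ≤ K := by
    have := (abs_nonneg _).trans (h.bound n hn 0)
    simpa using this
  calc _ ≤ K * Real.exp ((θ + s * x) ^ 2 / 6) * stdGauss x :=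
        mul_le_mul_of_nonneg_right (h.bound n hn _) (stdGauss_pos x).le
    _ = K * (Real.exp ((θ + s * x) ^ 2 / 6) * stdGauss x) := by ring
    _ ≤ K * (Real.exp (θ ^ 2 / 3) * Real.exp (-x ^ 2 / 11)) :=
        mul_le_mul_of_nonneg_left (exp_mul_stdGauss_le hs) hK
    _ = _ := by ring

lemma integrable (h : GaussianGrowth Φ m K) {n : ℕ} (hn : n ≤ m) {s : ℝ}
    (hs : |s| ≤ 11 / 10) (θ : ℝ) : Integrable (fun x => Φ n (θ + s * x) * stdGauss x) := by
  have hc := h.continuous n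
  have hg := continuous_stdGauss
  refine ((integrable_exp_neg_sq_div (b := 11) (by norm_num)).const_mul
    (K * Real.exp (θ ^ 2 / 3))).mono' (by fun_prop) (ae_of_all _ fun x => ?_)
  rw [Real.norm_eq_abs, abs_mul, abs_of_pos (stdGauss_pos x)]
  exact h.abs_mul_stdGauss_le hn hs θ x

lemma integrable_abs_mul_exp : Integrable (fun x : ℝ => |x| * Real.exp (-x ^ 2 / 11)) := by
  have := (integrable_mul_exp_neg_mul_sq (b := 1 / 11) (by norm_num)).abs
  convert this using 2 with x
  rw [abs_mul, abs_of_pos (Real.exp_pos _)]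
  congr 2
  ring

lemma abs_mul_mul_stdGauss_le (h : GaussianGrowth Φ m K) {n : ℕ} (hn : n ≤ m) {s : ℝ}
    (hs : |s| ≤ 11 / 10) (θ x : ℝ) : |Φ n (θ + s * x) * x * stdGauss x| ≤
      K * Real.exp (θ ^ 2 / 3) * (|x| * Real.exp (-x ^ 2 / 11)) := by
  rw [abs_mul, abs_mul, abs_of_pos (stdGauss_pos x)]
  calc _ = |x| * (|Φ n (θ + s * x)| * stdGauss x) := by ring
    _ ≤ |x| * (K * Real.exp (θ ^ 2 / 3) * Real.exp (-x ^ 2 / 11)) :=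
        mul_le_mul_of_nonneg_left (h.abs_mul_stdGauss_le hn hs θ x) (abs_nonneg x)
    _ = _ := by ring

lemma integrable_mul (h : GaussianGrowth Φ m K) {n : ℕ} (hn : n ≤ m) {s : ℝ}
    (hs : |s| ≤ 11 / 10) (θ : ℝ) : Integrable (fun x => Φ n (θ + s * x) * x * stdGauss x) := by
  have hc := h.continuous n
  have hg := continuous_stdGauss
  exact (integrable_abs_mul_exp.const_mul (K * Real.exp (θ ^ 2 / 3))).mono' (by fun_prop)
    (ae_of_all _ fun x => h.abs_mul_mul_stdGauss_le hn hs θ x)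

lemma hasDerivAt_integral (h : GaussianGrowth Φ m K) {n : ℕ} (hn : n + 2 ≤ m) {s : ℝ}
    (hs : |s| ≤ 1) (θ : ℝ) : HasDerivAt (fun s => ∫ x, Φ n (θ + s * x) * stdGauss x)
      (s * ∫ x, Φ (n + 2) (θ + s * x) * stdGauss x) s := by
  have hg := continuous_stdGauss
  have hs' : |s| ≤ 11 / 10 := by linarith
  have hball : ∀ t ∈ Metric.ball s (1 / 10), |t| ≤ 11 / 10 := by
    intro t ht
    rw [Metric.mem_ball, Real.dist_eq] at ht
    have := abs_sub_abs_le_abs_sub t s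
    linarith
  have hc := h.continuous
  have hinner : ∀ t x : ℝ, HasDerivAt (fun t : ℝ => θ + t * x) x t := fun t x => by
    simpa using ((hasDerivAt_id t).mul_const x).const_add θ
  have h1 := (hasDerivAt_integral_of_dominated_loc_of_deriv_le
    (F := fun s x => Φ n (θ + s * x) * stdGauss x)
    (F' := fun s x => Φ (n + 1) (θ + s * x) * x * stdGauss x)
    (bound := fun x => K * Real.exp (θ ^ 2 / 3) * (|x| * Real.exp (-x ^ 2 / 11)))
    (x₀ := s) (μ := volume)
    (Metric.ball_mem_nhds s (by norm_num : (0 : ℝ) < 1 / 10))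
    (Eventually.of_forall fun t => by have := hc n; fun_prop)
    (h.integrable (by omega) hs' θ) (by have := hc (n + 1); fun_prop)
    (ae_of_all _ fun x t ht => h.abs_mul_mul_stdGauss_le (by omega) (hball t ht) θ x)
    (integrable_abs_mul_exp.const_mul _)
    (ae_of_all _ fun x t _ => ((h.hasDerivAt n _).comp t (hinner t x)).mul_const _)).2
  have hinner' : ∀ x : ℝ, HasDerivAt (fun x : ℝ => θ + s * x) s x := fun x => by
    simpa using ((hasDerivAt_id x).const_mul s).const_add θ
  have hstein := integral_eq_zero_of_hasDerivAt_of_integrable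
    (f := fun x => Φ (n + 1) (θ + s * x) * stdGauss x)
    (f' := fun x => s * (Φ (n + 2) (θ + s * x) * stdGauss x) -
      Φ (n + 1) (θ + s * x) * x * stdGauss x)
    (fun x => by
      refine (((h.hasDerivAt (n + 1) _).comp x (hinner' x)).mul
        (hasDerivAt_stdGauss x)).congr_deriv ?_
      simp only [Function.comp_apply]
      ring)
    (((h.integrable hn hs' θ).const_mul s).sub (h.integrable_mul (by omega) hs' θ))
    (h.integrable (by omega) hs' θ)
  rw [integral_sub ((h.integrable hn hs' θ).const_mul s) (h.integrable_mul (by omega) hs' θ),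
    integral_const_mul, sub_eq_zero] at hstein
  rw [hstein]
  exact h1

lemma hasDerivAt_sum (h : GaussianGrowth Φ m K) {N : ℕ} (hN : 2 * (N + 1) ≤ m) {s : ℝ}
    (hs : |s| ≤ 1) (θ : ℝ) :
    HasDerivAt (fun s => ∑ k ∈ Finset.range (N + 1), (-(s ^ 2) / 2) ^ k / (Nat.factorial k : ℝ) *
        ∫ x, Φ (2 * k) (θ + s * x) * stdGauss x)
      (s * ((-(s ^ 2) / 2) ^ N / (Nat.factorial N : ℝ)) *
        ∫ x, Φ (2 * (N + 1)) (θ + s * x) * stdGauss x) s := by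
  induction N with
  | zero =>
    have := h.hasDerivAt_integral (n := 0) (by omega) hs θ
    simpa using this
  | succ N ih =>
    have hq : HasDerivAt (fun s : ℝ => -(s ^ 2) / 2) (-s) s := by
      refine ((hasDerivAt_pow 2 s).neg.div_const 2).congr_deriv ?_
      norm_num
      ring
    have ha : HasDerivAt (fun s : ℝ => (-(s ^ 2) / 2) ^ (N + 1) / (Nat.factorial (N + 1) : ℝ))
        (-s * ((-(s ^ 2) / 2) ^ N / (Nat.factorial N : ℝ))) s := by
      refine ((hq.pow (N + 1)).div_const (Nat.factorial (N + 1) : ℝ)).congr_deriv ?_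
      rw [Nat.factorial_succ]
      push_cast [Nat.add_sub_cancel]
      have : (Nat.factorial N : ℝ) ≠ 0 := by positivity
      field_simp
    have hI := h.hasDerivAt_integral (n := 2 * (N + 1)) (by omega) hs θ
    have hsum := (ih (by omega)).add (ha.mul hI)
    simp only [Finset.sum_range_succ _ (N + 1)]
    refine hsum.congr_deriv ?_
    rw [show 2 * (N + 1 + 1) = 2 * (N + 1) + 2 by ring]
    ring

/-- Truncated inversion of the heat semigroup at time one: the error is controlled by the
derivative of order `2 * (N + 1)`. -/
lemma abs_heat_inversion_sub_le (h : GaussianGrowth Φ m K) {N : ℕ} (hN : 2 * (N + 1) ≤ m) (θ : ℝ)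
    {B : ℝ} (hB : ∀ s ∈ Set.Icc (0 : ℝ) 1,
      |∫ x, Φ (2 * (N + 1)) (θ + s * x) * stdGauss x| ≤ B) :
    |∑ k ∈ Finset.range (N + 2), (-1 / 2 : ℝ) ^ k / (Nat.factorial k : ℝ) *
        (∫ x, Φ (2 * k) (θ + x) * stdGauss x) - Φ 0 θ| ≤
      (2 * (N : ℝ) + 3) * (B / (2 ^ (N + 1) * (Nat.factorial (N + 1) : ℝ))) := by
  set F : ℝ → ℝ := fun s => ∑ k ∈ Finset.range (N + 1),
    (-(s ^ 2) / 2) ^ k / (Nat.factorial k : ℝ) * ∫ x, Φ (2 * k) (θ + s * x) * stdGauss x with hF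
  have hB0 : 0 ≤ B := (abs_nonneg _).trans (hB 0 (by simp))
  have hmv := norm_image_sub_le_of_norm_deriv_le_segment_01' (f := F)
    (f' := fun s => s * ((-(s ^ 2) / 2) ^ N / (Nat.factorial N : ℝ)) *
        ∫ x, Φ (2 * (N + 1)) (θ + s * x) * stdGauss x)
    (C := 1 / (2 ^ N * (Nat.factorial N : ℝ)) * B)
    (fun s hs => (h.hasDerivAt_sum hN (abs_le.mpr ⟨by linarith [hs.1], hs.2⟩) θ).hasDerivWithinAt)
    (fun s hs => by
      have h0 := hs.1
      have h1 := hs.2.le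
      rw [Real.norm_eq_abs, abs_mul]
      gcongr
      · rw [abs_mul, abs_of_nonneg h0, abs_div, abs_pow, abs_div, abs_neg, Nat.abs_cast,
          abs_of_nonneg (sq_nonneg s), abs_two, div_pow, div_div, ← mul_div_assoc]
        gcongr
        exact mul_le_one₀ h1 (by positivity) (pow_le_one₀ (by positivity) (pow_le_one₀ h0 h1))
      · exact hB s ⟨h0, h1⟩)
  have hF0 : F 0 = Φ 0 θ := by
    simp only [hF, Finset.sum_range_succ']
    simp [integral_const_mul, integral_stdGauss]
  rw [hF0, Real.norm_eq_abs] at hmv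
  have hlast := hB 1 (by simp)
  have hF1 : ∑ k ∈ Finset.range (N + 2), (-1 / 2 : ℝ) ^ k / (Nat.factorial k : ℝ) *
      (∫ x, Φ (2 * k) (θ + x) * stdGauss x) = F 1 + (-1 / 2 : ℝ) ^ (N + 1) /
        (Nat.factorial (N + 1) : ℝ) * ∫ x, Φ (2 * (N + 1)) (θ + 1 * x) * stdGauss x := by
    rw [Finset.sum_range_succ _ (N + 1)]
    simp [hF]
  rw [hF1]
  have habs : |(-1 / 2 : ℝ) ^ (N + 1) / (Nat.factorial (N + 1) : ℝ) *
      ∫ x, Φ (2 * (N + 1)) (θ + 1 * x) * stdGauss x| ≤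
      B / (2 ^ (N + 1) * (Nat.factorial (N + 1) : ℝ)) := by
    rw [abs_mul, abs_div, abs_pow, Nat.abs_cast,
      show |(-1 / 2 : ℝ)| = 1 / 2 by norm_num [abs_of_neg], div_pow, one_pow, div_div]
    calc _ ≤ 1 / (2 ^ (N + 1) * (Nat.factorial (N + 1) : ℝ)) * B := by gcongr
      _ = _ := by ring
  calc _ = |(F 1 - Φ 0 θ) + (-1 / 2 : ℝ) ^ (N + 1) /
        (Nat.factorial (N + 1) : ℝ) * ∫ x, Φ (2 * (N + 1)) (θ + 1 * x) * stdGauss x| := by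
        congr 1; ring
    _ ≤ 1 / (2 ^ N * (Nat.factorial N : ℝ)) * B +
        B / (2 ^ (N + 1) * (Nat.factorial (N + 1) : ℝ)) :=
        (abs_add_le _ _).trans (add_le_add hmv habs)
    _ = _ := by
        rw [Nat.factorial_succ, pow_succ]
        push_cast
        have : (Nat.factorial N : ℝ) ≠ 0 := by positivity
        field_simp
        ring

end GaussianGrowth

lemma integrable_exp_mul_stdGauss {s : ℝ} (hs : |s| ≤ 11 / 10) (θ : ℝ) :
    Integrable (fun x => Real.exp ((θ + s * x) ^ 2 / 6) * stdGauss x) := by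
  have hg := continuous_stdGauss
  refine ((integrable_exp_neg_sq_div (b := 11) (by norm_num)).const_mul
    (Real.exp (θ ^ 2 / 3))).mono' (by fun_prop) (ae_of_all _ fun x => ?_)
  rw [Real.norm_eq_abs, abs_of_pos (mul_pos (Real.exp_pos _) (stdGauss_pos x))]
  exact exp_mul_stdGauss_le hs

lemma integral_exp_mul_stdGauss_le {s : ℝ} (hs : |s| ≤ 1) (θ : ℝ) :
    ∫ x, Real.exp ((θ + s * x) ^ 2 / 6) * stdGauss x ≤ 2 * Real.exp (θ ^ 2 / 3) := by
  have hs2 : s ^ 2 ≤ 1 := by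
    rw [← sq_abs]
    exact pow_le_one₀ (abs_nonneg s) hs
  calc _ ≤ ∫ x : ℝ, (Real.exp (θ ^ 2 / 3) * (1 / Real.sqrt (2 * Real.pi))) *
        Real.exp (-x ^ 2 / 6) := by
        refine integral_mono (integrable_exp_mul_stdGauss (by linarith) θ)
          ((integrable_exp_neg_sq_div (by norm_num)).const_mul _) fun x => ?_
        simp only [stdGauss]
        calc _ = (1 / Real.sqrt (2 * Real.pi)) * Real.exp ((θ + s * x) ^ 2 / 6 + -x ^ 2 / 2) := by
              rw [Real.exp_add]; ring
          _ ≤ (1 / Real.sqrt (2 * Real.pi)) * Real.exp (θ ^ 2 / 3 + -x ^ 2 / 6) := by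
              refine mul_le_mul_of_nonneg_left (Real.exp_le_exp.mpr ?_) (by positivity)
              nlinarith [sq_nonneg (θ - s * x), mul_le_mul_of_nonneg_right hs2 (sq_nonneg x)]
          _ = _ := by rw [Real.exp_add]; ring
    _ = Real.exp (θ ^ 2 / 3) * (Real.sqrt (6 * Real.pi) / Real.sqrt (2 * Real.pi)) := by
        rw [integral_const_mul, integral_exp_neg_sq_div (by norm_num)]
        ring
    _ ≤ Real.exp (θ ^ 2 / 3) * 2 := by
        gcongr
        rw [div_le_iff₀ (by positivity), ← Real.sqrt_sq (by norm_num : (0 : ℝ) ≤ 2),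
          ← Real.sqrt_mul (by norm_num), Real.sqrt_sq (by norm_num : (0 : ℝ) ≤ 2)]
        exact Real.sqrt_le_sqrt (by nlinarith [Real.pi_pos])
    _ = _ := by ring

/-- A Gaussian weight dominating the link density and its derivatives. -/
noncomputable def wideGauss (z : ℝ) : ℝ := (1 / Real.sqrt (2 * Real.pi)) * Real.exp (-z ^ 2 / 4)

lemma wideGauss_pos (z : ℝ) : 0 < wideGauss z := by unfold wideGauss; positivity

lemma continuous_wideGauss : Continuous wideGauss := by unfold wideGauss; fun_prop

lemma integrable_wideGauss_sub (m : ℝ) : Integrable (fun y => wideGauss (y - m)) :=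
  ((integrable_exp_neg_sq_div (b := 4) (by norm_num)).const_mul _).comp_sub_right m

lemma integral_wideGauss_sub_le (m : ℝ) : ∫ y, wideGauss (y - m) ≤ 2 := by
  rw [integral_sub_right_eq_self wideGauss m]
  unfold wideGauss
  rw [integral_const_mul, integral_exp_neg_sq_div (by norm_num), one_div_mul_eq_div,
    div_le_iff₀ (by positivity), ← Real.sqrt_sq (by norm_num : (0 : ℝ) ≤ 2),
    ← Real.sqrt_mul (by norm_num), Real.sqrt_sq (by norm_num : (0 : ℝ) ≤ 2)]
  exact Real.sqrt_le_sqrt (by nlinarith [Real.pi_pos])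

lemma exp_three_halves_le : Real.exp (3 / 2) ≤ 5 := by
  have h : Real.exp (3 / 2) ^ 2 = Real.exp 1 ^ 3 := by
    rw [← Real.exp_nat_mul, ← Real.exp_nat_mul]
    norm_num
  have h1 : Real.exp 1 ^ 3 ≤ 2.72 ^ 3 := by
    gcongr
    linarith [Real.exp_one_lt_d9]
  nlinarith [Real.exp_pos (3 / 2 : ℝ)]

lemma exp_nine_halves_le : Real.exp (9 / 2) ≤ 125 := by
  have h : Real.exp (9 / 2) = Real.exp (3 / 2) ^ 3 := by
    rw [← Real.exp_nat_mul]
    norm_num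
  rw [h]
  calc _ ≤ (5 : ℝ) ^ 3 := by
        gcongr
        exact exp_three_halves_le
    _ = _ := by norm_num

lemma gauss_exp_abs_le_wideGauss (z : ℝ) :
    (1 / Real.sqrt (2 * Real.pi)) * Real.exp (-z ^ 2 / 2 + |z| + 1 / 2) ≤ 5 * wideGauss z := by
  have h : Real.exp (-z ^ 2 / 2 + |z| + 1 / 2) ≤ 5 * Real.exp (-z ^ 2 / 4) := by
    calc _ ≤ Real.exp (3 / 2 + -z ^ 2 / 4) :=
          Real.exp_le_exp.mpr (by nlinarith [sq_nonneg (|z| / 2 - 1), sq_abs z])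
      _ ≤ _ := by
          rw [Real.exp_add]
          gcongr
          exact exp_three_halves_le
  calc _ ≤ (1 / Real.sqrt (2 * Real.pi)) * (5 * Real.exp (-z ^ 2 / 4)) := by gcongr
    _ = _ := by unfold wideGauss; ring

lemma gauss_exp_two_abs_le_wideGauss (z : ℝ) :
    (1 / Real.sqrt (2 * Real.pi)) * Real.exp (-z ^ 2 / 2 + 2 * |z| + 1 / 2) ≤
      125 * wideGauss z := by
  have h : Real.exp (-z ^ 2 / 2 + 2 * |z| + 1 / 2) ≤ 125 * Real.exp (-z ^ 2 / 4) := by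
    calc _ ≤ Real.exp (9 / 2 + -z ^ 2 / 4) :=
          Real.exp_le_exp.mpr (by nlinarith [sq_nonneg (|z| / 2 - 2), sq_abs z])
      _ ≤ _ := by
          rw [Real.exp_add]
          gcongr
          exact exp_nine_halves_le
  calc _ ≤ (1 / Real.sqrt (2 * Real.pi)) * (125 * Real.exp (-z ^ 2 / 4)) := by gcongr
    _ = _ := by unfold wideGauss; ring

/-- The `n`-th parameter derivative of the link density. -/
noncomputable def linkDeriv (f : ℝ → ℝ) (τ : ℝ) (n : ℕ) (y x : ℝ) : ℝ :=
  iteratedDeriv n (fun θ => linkDensity f τ y θ) x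

/-- The growth factor `1 + exp(x²/6 − τ²/24)`. -/
noncomputable def growthFactor (τ x : ℝ) : ℝ := 1 + Real.exp (x ^ 2 / 6 - τ ^ 2 / 24)

lemma growthFactor_nonneg (τ x : ℝ) : 0 ≤ growthFactor τ x := by unfold growthFactor; positivity

lemma continuous_growthFactor (τ : ℝ) : Continuous (growthFactor τ) := by
  unfold growthFactor; fun_prop

lemma growthFactor_le (τ x : ℝ) : growthFactor τ x ≤ 2 * Real.exp (x ^ 2 / 6) := by
  unfold growthFactor
  have h1 : 1 ≤ Real.exp (x ^ 2 / 6) := Real.one_le_exp (by positivity)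
  have h2 : Real.exp (x ^ 2 / 6 - τ ^ 2 / 24) ≤ Real.exp (x ^ 2 / 6) :=
    Real.exp_le_exp.mpr (by nlinarith [sq_nonneg τ])
  linarith

lemma growthFactor_mul_stdGauss_eq (τ θ s x : ℝ) : growthFactor τ (θ + s * x) * stdGauss x =
    stdGauss x + Real.exp (-(τ ^ 2 / 24)) * (Real.exp ((θ + s * x) ^ 2 / 6) * stdGauss x) := by
  unfold growthFactor
  rw [sub_eq_add_neg, Real.exp_add]
  ring

lemma integrable_growthFactor {s : ℝ} (hs : |s| ≤ 1) (τ θ : ℝ) :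
    Integrable (fun x => growthFactor τ (θ + s * x) * stdGauss x) := by
  simp only [growthFactor_mul_stdGauss_eq]
  exact integrable_stdGauss.add ((integrable_exp_mul_stdGauss (by linarith) θ).const_mul _)

lemma integral_growthFactor_le {s : ℝ} (hs : |s| ≤ 1) {τ θ : ℝ} (hθ : 8 * θ ^ 2 ≤ τ ^ 2) :
    ∫ x, growthFactor τ (θ + s * x) * stdGauss x ≤ 3 := by
  simp only [growthFactor_mul_stdGauss_eq]
  rw [integral_add integrable_stdGauss
    ((integrable_exp_mul_stdGauss (by linarith) θ).const_mul _), integral_const_mul,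
    integral_stdGauss]
  have h : Real.exp (-(τ ^ 2 / 24)) * (2 * Real.exp (θ ^ 2 / 3)) ≤ 2 := by
    rw [mul_left_comm, ← Real.exp_add]
    have : Real.exp (-(τ ^ 2 / 24) + θ ^ 2 / 3) ≤ 1 := Real.exp_le_one_iff.mpr (by linarith)
    linarith
  have := mul_le_mul_of_nonneg_left (integral_exp_mul_stdGauss_le hs θ)
    (Real.exp_pos (-(τ ^ 2 / 24))).le
  linarith

/-- The quantitative control on the link function under which the deficiency is estimated. -/
structure LinkBound (f : ℝ → ℝ) (Ct τ Λ : ℝ) (N : ℕ) : Prop where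
  smooth : ContDiff ℝ (⊤ : ℕ∞) f
  Ct_pos : 0 < Ct
  tau_pos : 0 < τ
  N_pos : 1 ≤ N
  one_le : 1 ≤ Λ
  inner : ∀ x, |x| ≤ τ → derivSumF f Ct (2 * N) (x / τ) ≤ Λ
  outer : ∀ x, τ ≤ |x| → derivSumF f Ct (2 * N) (x / τ) ≤ Λ * Real.exp (x ^ 2 / (16 * (N : ℝ)))
  scale : 100 * ((N : ℝ) * (Ct * Λ)) ^ 2 ≤ τ ^ 2

lemma derivSumF_mono {f : ℝ → ℝ} {Ct : ℝ} (hCt : 0 < Ct) {m n : ℕ} (h : m ≤ n) (t : ℝ) :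
    derivSumF f Ct m t ≤ derivSumF f Ct n t :=
  Finset.sum_le_sum_of_subset_of_nonneg (Finset.Icc_subset_Icc_right h)
    fun _ _ _ => by positivity

lemma derivSumF_nonneg {f : ℝ → ℝ} {Ct : ℝ} (hCt : 0 < Ct) (n : ℕ) (t : ℝ) :
    0 ≤ derivSumF f Ct n t :=
  Finset.sum_nonneg fun _ _ => by positivity

lemma continuous_derivSumF {f : ℝ → ℝ} (hf : ContDiff ℝ (⊤ : ℕ∞) f) (Ct : ℝ) (n : ℕ) :
    Continuous (derivSumF f Ct n) :=
  continuous_finsetSum _ fun j _ =>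
    (hf.continuous_iteratedDeriv j (by exact_mod_cast le_top)).abs.div_const _

lemma continuous_linkDeriv {f : ℝ → ℝ} (hf : ContDiff ℝ (⊤ : ℕ∞) f) (τ : ℝ) (n : ℕ) :
    Continuous (fun p : ℝ × ℝ => linkDeriv f τ n p.1 p.2) :=
  (contDiff_iteratedDeriv_snd (F := linkDensity f τ) (contDiff_linkDensity hf τ) n).continuous

lemma wideGauss_sub_le (y m : ℝ) :
    wideGauss (y - m) ≤ Real.exp (m ^ 2 / 4) * Real.exp (-y ^ 2 / 8) := by
  unfold wideGauss
  rw [← Real.exp_add]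
  calc _ ≤ 1 * Real.exp (-(y - m) ^ 2 / 4) := by
        gcongr
        exact one_div_sqrt_two_pi_le_one
    _ ≤ _ := by
        rw [one_mul]
        exact Real.exp_le_exp.mpr (by nlinarith [sq_nonneg (y - 2 * m)])

lemma abs_linkDeriv_le {f : ℝ → ℝ} (hf : ContDiff ℝ (⊤ : ℕ∞) f) {Ct τ : ℝ}
    (hCt : 0 < Ct) (hτ : 0 < τ) {n : ℕ} {x D : ℝ} (hD : 1 ≤ D)
    (hder : derivSumF f Ct n (x / τ) ≤ D) (y : ℝ) :
    |linkDeriv f τ n y x| ≤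
      (Nat.factorial n : ℝ) * (Ct * D / τ) ^ n * (5 * wideGauss (y - f (x / τ))) := by
  have h := abs_iteratedDeriv_linkDensity_le hf hCt hτ (y := y) hD le_rfl hder
  rw [mul_one, div_one, mul_assoc _ (1 / Real.sqrt (2 * Real.pi))] at h
  exact h.trans (mul_le_mul_of_nonneg_left (gauss_exp_abs_le_wideGauss _) (by positivity))

lemma exists_abs_linkDeriv_le_ball {f : ℝ → ℝ} (hf : ContDiff ℝ (⊤ : ℕ∞) f) {τ : ℝ}
    (hτ : 0 < τ) (n : ℕ) (x₀ : ℝ) :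
    ∃ K, ∀ x ∈ Metric.ball x₀ 1, ∀ y, |linkDeriv f τ n y x| ≤ K * Real.exp (-y ^ 2 / 8) := by
  have hk : IsCompact (Metric.closedBall x₀ (1 : ℝ)) := isCompact_closedBall x₀ 1
  have hc := continuous_derivSumF hf 1 n
  have hfc := hf.continuous
  obtain ⟨D, hD⟩ := hk.exists_bound_of_continuousOn (f := fun x => derivSumF f 1 n (x / τ))
    (by fun_prop)
  obtain ⟨M, hM⟩ := hk.exists_bound_of_continuousOn (f := fun x => f (x / τ)) (by fun_prop)
  refine ⟨(Nat.factorial n : ℝ) * (1 * max D 1 / τ) ^ n * (5 * Real.exp (M ^ 2 / 4)), ?_⟩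
  intro x hx y
  have hx' := Metric.ball_subset_closedBall hx
  have h1 : derivSumF f 1 n (x / τ) ≤ max D 1 :=
    (le_abs_self _).trans ((hD x hx').trans (le_max_left _ _))
  have h2 : f (x / τ) ^ 2 ≤ M ^ 2 := by
    have := hM x hx'
    rw [Real.norm_eq_abs] at this
    rw [← sq_abs]
    exact pow_le_pow_left₀ (abs_nonneg _) this 2
  have h3 : wideGauss (y - f (x / τ)) ≤ Real.exp (M ^ 2 / 4) * Real.exp (-y ^ 2 / 8) := by
    refine (wideGauss_sub_le _ _).trans (mul_le_mul_of_nonneg_right ?_ (Real.exp_pos _).le)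
    exact Real.exp_le_exp.mpr (by linarith)
  refine (abs_linkDeriv_le hf one_pos hτ (le_max_right _ _) h1 y).trans ?_
  have : 0 ≤ (Nat.factorial n : ℝ) * (1 * max D 1 / τ) ^ n := by positivity
  calc _ ≤ (Nat.factorial n : ℝ) * (1 * max D 1 / τ) ^ n *
        (5 * (Real.exp (M ^ 2 / 4) * Real.exp (-y ^ 2 / 8))) := by
        exact mul_le_mul_of_nonneg_left (by linarith) this
    _ = _ := by ring

lemma continuous_linkDeriv_left {f : ℝ → ℝ} (hf : ContDiff ℝ (⊤ : ℕ∞) f) (τ : ℝ) (n : ℕ)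
    (x : ℝ) : Continuous (fun y => linkDeriv f τ n y x) := by
  have h := continuous_linkDeriv hf τ n
  generalize linkDeriv f τ n = g at h ⊢
  fun_prop

/-- The `n`-th derivative of `x ↦ ∫ χ(y)·v(y;x) dy`. -/
noncomputable def testDeriv (f : ℝ → ℝ) (τ : ℝ) (χ : ℝ → ℝ) (n : ℕ) (x : ℝ) : ℝ :=
  ∫ y, χ y * linkDeriv f τ n y x

lemma integrable_mul_linkDeriv {f : ℝ → ℝ} (hf : ContDiff ℝ (⊤ : ℕ∞) f) {τ : ℝ} (hτ : 0 < τ)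
    {χ : ℝ → ℝ} (hχ : Measurable χ) (hχ1 : ∀ y, |χ y| ≤ 1) (n : ℕ) (x : ℝ) :
    Integrable (fun y => χ y * linkDeriv f τ n y x) := by
  obtain ⟨K, hK⟩ := exists_abs_linkDeriv_le_ball hf hτ n x
  have hc : Continuous (fun y => linkDeriv f τ n y x) :=
    continuous_linkDeriv_left hf τ n x
  refine ((integrable_exp_neg_sq_div (b := 8) (by norm_num)).const_mul K).mono'
    (hχ.mul hc.measurable).aestronglyMeasurable (ae_of_all _ fun y => ?_)
  rw [Real.norm_eq_abs, abs_mul]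
  exact (mul_le_of_le_one_left (abs_nonneg _) (hχ1 y)).trans
    (hK x (Metric.mem_ball_self one_pos) y)

lemma hasDerivAt_testDeriv {f : ℝ → ℝ} (hf : ContDiff ℝ (⊤ : ℕ∞) f) {τ : ℝ} (hτ : 0 < τ)
    {χ : ℝ → ℝ} (hχ : Measurable χ) (hχ1 : ∀ y, |χ y| ≤ 1) (n : ℕ) (x : ℝ) :
    HasDerivAt (testDeriv f τ χ n) (testDeriv f τ χ (n + 1) x) x := by
  obtain ⟨K, hK⟩ := exists_abs_linkDeriv_le_ball hf hτ (n + 1) x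
  have hint := fun n x => integrable_mul_linkDeriv hf hτ hχ hχ1 n x
  refine (hasDerivAt_integral_of_dominated_loc_of_deriv_le
    (F := fun x y => χ y * linkDeriv f τ n y x)
    (F' := fun x y => χ y * linkDeriv f τ (n + 1) y x)
    (bound := fun y => K * Real.exp (-y ^ 2 / 8))
    (Metric.ball_mem_nhds x one_pos) (Eventually.of_forall fun x => (hint n x).1) (hint n x)
    (hint (n + 1) x).1 (ae_of_all _ fun y x hx => ?_)
    ((integrable_exp_neg_sq_div (by norm_num)).const_mul K) (ae_of_all _ fun y x hx => ?_)).2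
  · rw [Real.norm_eq_abs, abs_mul]
    exact (mul_le_of_le_one_left (abs_nonneg _) (hχ1 y)).trans (hK x hx y)
  · refine (hasDerivAt_iteratedDeriv ?_ n x).const_mul (χ y)
    exact (contDiff_linkDensity hf τ).comp
      (contDiff_const.prodMk contDiff_id)

namespace LinkBound

variable {f : ℝ → ℝ} {Ct τ Λ : ℝ} {N : ℕ}

lemma exists_majorant (h : LinkBound f Ct τ Λ N) (x : ℝ) :
    ∃ D, 1 ≤ D ∧ derivSumF f Ct (2 * N) (x / τ) ≤ D ∧
      ∀ n ≤ 2 * N, D ^ n ≤ Λ ^ n * growthFactor τ x := by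
  have hΛ := h.one_le
  have hN : (0 : ℝ) < N := by exact_mod_cast h.N_pos
  rcases le_total |x| τ with hx | hx
  · refine ⟨Λ, hΛ, h.inner x hx, fun n _ => le_mul_of_one_le_right (by positivity) ?_⟩
    unfold growthFactor
    linarith [Real.exp_pos (x ^ 2 / 6 - τ ^ 2 / 24)]
  · refine ⟨Λ * Real.exp (x ^ 2 / (16 * (N : ℝ))), ?_, h.outer x hx, fun n hn => ?_⟩
    · exact one_le_mul_of_one_le_of_one_le hΛ (Real.one_le_exp (by positivity))
    · rw [mul_pow, ← Real.exp_nat_mul]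
      refine mul_le_mul_of_nonneg_left ?_ (by positivity)
      have hn' : (n : ℝ) ≤ 2 * N := by exact_mod_cast hn
      have h1 : (n : ℝ) * (x ^ 2 / (16 * (N : ℝ))) ≤ x ^ 2 / 8 := by
        calc _ ≤ 2 * (N : ℝ) * (x ^ 2 / (16 * (N : ℝ))) :=
              mul_le_mul_of_nonneg_right hn' (by positivity)
          _ = _ := by field_simp; ring
      have h2 : τ ^ 2 ≤ x ^ 2 := by
        rw [← sq_abs x]
        exact pow_le_pow_left₀ h.tau_pos.le hx 2
      have h3 : Real.exp ((n : ℝ) * (x ^ 2 / (16 * (N : ℝ)))) ≤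
          Real.exp (x ^ 2 / 6 - τ ^ 2 / 24) := Real.exp_le_exp.mpr (by linarith)
      unfold growthFactor
      linarith

lemma abs_linkDeriv_le (h : LinkBound f Ct τ Λ N) {n : ℕ} (hn : n ≤ 2 * N) (y x : ℝ) :
    |linkDeriv f τ n y x| ≤ (Nat.factorial n : ℝ) * (Ct * Λ / τ) ^ n *
      (growthFactor τ x * (5 * wideGauss (y - f (x / τ)))) := by
  obtain ⟨D, hD1, hD, hDn⟩ := h.exists_majorant x
  have hCt := h.Ct_pos
  have hτ := h.tau_pos
  have hw := wideGauss_pos (y - f (x / τ))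
  refine (_root_.abs_linkDeriv_le h.smooth hCt hτ hD1
    ((derivSumF_mono hCt hn _).trans hD) y).trans ?_
  calc _ = (Nat.factorial n : ℝ) * (Ct / τ) ^ n * (5 * wideGauss (y - f (x / τ))) * D ^ n := by
        rw [mul_div_right_comm, mul_pow]; ring
    _ ≤ (Nat.factorial n : ℝ) * (Ct / τ) ^ n * (5 * wideGauss (y - f (x / τ))) *
        (Λ ^ n * growthFactor τ x) := mul_le_mul_of_nonneg_left (hDn n hn) (by positivity)
    _ = _ := by rw [mul_div_right_comm, mul_pow]; ring

lemma abs_testDeriv_le (h : LinkBound f Ct τ Λ N) {χ : ℝ → ℝ} (hχ1 : ∀ y, |χ y| ≤ 1)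
    {n : ℕ} (hn : n ≤ 2 * N) (x : ℝ) :
    |testDeriv f τ χ n x| ≤
      (Nat.factorial n : ℝ) * (Ct * Λ / τ) ^ n * 10 * growthFactor τ x := by
  have hCt := h.Ct_pos
  have hτ := h.tau_pos
  have hΛ := h.one_le
  have hg := growthFactor_nonneg τ x
  unfold testDeriv
  rw [← Real.norm_eq_abs]
  refine (norm_integral_le_of_norm_le
    (((integrable_wideGauss_sub (f (x / τ))).const_mul
      ((Nat.factorial n : ℝ) * (Ct * Λ / τ) ^ n * (growthFactor τ x * 5))))
    (ae_of_all _ fun y => ?_)).trans ?_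
  · rw [Real.norm_eq_abs, abs_mul]
    refine (mul_le_of_le_one_left (abs_nonneg _) (hχ1 y)).trans
      ((h.abs_linkDeriv_le hn y x).trans_eq ?_)
    ring
  · rw [integral_const_mul]
    calc _ ≤ (Nat.factorial n : ℝ) * (Ct * Λ / τ) ^ n * (growthFactor τ x * 5) * 2 :=
          mul_le_mul_of_nonneg_left (integral_wideGauss_sub_le _) (by positivity)
      _ = _ := by ring

lemma gaussianGrowth (h : LinkBound f Ct τ Λ N) {χ : ℝ → ℝ} (hχ : Measurable χ)
    (hχ1 : ∀ y, |χ y| ≤ 1) :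
    GaussianGrowth (testDeriv f τ χ) (2 * N)
      (∑ n ∈ Finset.range (2 * N + 1), (Nat.factorial n : ℝ) * (Ct * Λ / τ) ^ n * 20) where
  hasDerivAt := hasDerivAt_testDeriv h.smooth h.tau_pos hχ hχ1
  bound n hn x := by
    have hCt := h.Ct_pos
    have hτ := h.tau_pos
    have hΛ := h.one_le
    calc _ ≤ (Nat.factorial n : ℝ) * (Ct * Λ / τ) ^ n * 10 * growthFactor τ x :=
          h.abs_testDeriv_le hχ1 hn x
      _ ≤ (Nat.factorial n : ℝ) * (Ct * Λ / τ) ^ n * 10 * (2 * Real.exp (x ^ 2 / 6)) :=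
          mul_le_mul_of_nonneg_left (growthFactor_le τ x) (by positivity)
      _ = (Nat.factorial n : ℝ) * (Ct * Λ / τ) ^ n * 20 * Real.exp (x ^ 2 / 6) := by ring
      _ ≤ _ := by
          refine mul_le_mul_of_nonneg_right ?_ (Real.exp_pos _).le
          exact Finset.single_le_sum
            (f := fun n => (Nat.factorial n : ℝ) * (Ct * Λ / τ) ^ n * 20)
            (fun i _ => by positivity) (Finset.mem_range.mpr (by omega))

lemma abs_integral_testDeriv_le (h : LinkBound f Ct τ Λ N) {χ : ℝ → ℝ}
    (hχ1 : ∀ y, |χ y| ≤ 1) {θ s : ℝ} (hθ : 8 * θ ^ 2 ≤ τ ^ 2) (hs : |s| ≤ 1) :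
    |∫ x, testDeriv f τ χ (2 * N) (θ + s * x) * stdGauss x| ≤
      (Nat.factorial (2 * N) : ℝ) * (Ct * Λ / τ) ^ (2 * N) * 30 := by
  have hCt := h.Ct_pos
  have hτ := h.tau_pos
  have hΛ := h.one_le
  rw [← Real.norm_eq_abs]
  refine (norm_integral_le_of_norm_le ((integrable_growthFactor hs τ θ).const_mul
    ((Nat.factorial (2 * N) : ℝ) * (Ct * Λ / τ) ^ (2 * N) * 10))
    (ae_of_all _ fun x => ?_)).trans ?_
  · rw [Real.norm_eq_abs, abs_mul, abs_of_pos (stdGauss_pos x), ← mul_assoc]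
    exact mul_le_mul_of_nonneg_right (h.abs_testDeriv_le hχ1 le_rfl _) (stdGauss_pos x).le
  · rw [integral_const_mul]
    calc _ ≤ (Nat.factorial (2 * N) : ℝ) * (Ct * Λ / τ) ^ (2 * N) * 10 * 3 :=
          mul_le_mul_of_nonneg_left (integral_growthFactor_le hs hθ) (by positivity)
      _ = _ := by ring

end LinkBound

lemma factorial_two_mul_div_mul_pow_le {k N : ℕ} (hk : k ≤ N) (a : ℝ) :
    (Nat.factorial (2 * k) : ℝ) / (2 ^ k * (Nat.factorial k : ℝ)) * a ^ (2 * k) ≤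
      ((N : ℝ) * a ^ 2) ^ k := by
  have h1 : (Nat.factorial (2 * k) : ℝ) ≤ (2 * (k : ℝ)) ^ k * (Nat.factorial k : ℝ) := by
    exact_mod_cast Nat.factorial_two_mul_le k
  have hk' : (k : ℝ) ≤ N := by exact_mod_cast hk
  rw [pow_mul, mul_pow]
  refine mul_le_mul_of_nonneg_right ?_ (by positivity)
  rw [div_le_iff₀ (by positivity)]
  calc _ ≤ (2 * (k : ℝ)) ^ k * (Nat.factorial k : ℝ) := h1
    _ ≤ (2 * (N : ℝ)) ^ k * (Nat.factorial k : ℝ) := by gcongr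
    _ = _ := by rw [mul_pow]; ring

lemma geom_sum_le_of_le {r : ℝ} (h0 : 0 ≤ r) (h1 : r ≤ 1 / 100) (n : ℕ) :
    ∑ k ∈ Finset.range n, r ^ k ≤ 100 / 99 := by
  induction n with
  | zero => norm_num
  | succ n ih =>
    rw [Finset.sum_range_succ']
    simp only [pow_succ, ← Finset.sum_mul]
    have : 0 ≤ ∑ k ∈ Finset.range n, r ^ k := Finset.sum_nonneg fun _ _ => by positivity
    nlinarith

lemma srcDensity_one (θ x : ℝ) : srcDensity 1 θ x = stdGauss (x - θ) := by
  simp [srcDensity, stdGauss]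

lemma integral_mul_srcDensity (g : ℝ → ℝ) (θ : ℝ) :
    ∫ x, g x * srcDensity 1 θ x = ∫ x, g (θ + x) * stdGauss x := by
  rw [← integral_add_left_eq_self (fun x => g x * srcDensity 1 θ x) θ]
  simp [srcDensity_one]

lemma integrable_mul_srcDensity_iff (g : ℝ → ℝ) (θ : ℝ) :
    Integrable (fun x => g x * srcDensity 1 θ x) ↔
      Integrable (fun x => g (θ + x) * stdGauss x) := by
  have h : (fun x => g (θ + x) * stdGauss x) =
      fun x => (fun x => g x * srcDensity 1 θ x) (θ + x) := by
    ext x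
    simp [srcDensity_one]
  rw [h]
  refine ⟨fun hi => hi.comp_add_left θ, fun hi => ?_⟩
  simpa using hi.comp_add_left (-θ)

lemma signedKernel_one_eq (f : ℝ → ℝ) (τ : ℝ) (N : ℕ) (y x : ℝ) :
    signedKernel 1 (linkDensity f τ) N y x = ∑ k ∈ Finset.range (N + 1),
      (-1 / 2 : ℝ) ^ k / (Nat.factorial k : ℝ) * linkDeriv f τ (2 * k) y x := by
  unfold signedKernel linkDeriv
  refine Finset.sum_congr rfl fun k _ => ?_
  rw [one_pow, mul_one, div_pow, div_div]

lemma abs_signedKernel_coeff (k : ℕ) :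
    |(-1 / 2 : ℝ) ^ k / (Nat.factorial k : ℝ)| = 1 / (2 ^ k * (Nat.factorial k : ℝ)) := by
  rw [abs_div, abs_pow, Nat.abs_cast, show |(-1 / 2 : ℝ)| = 1 / 2 by norm_num [abs_div], div_pow,
    one_pow, div_div]

namespace LinkBound

variable {f : ℝ → ℝ} {Ct τ Λ : ℝ} {N : ℕ}

lemma sq_ratio_le (h : LinkBound f Ct τ Λ N) : (N : ℝ) * (Ct * Λ / τ) ^ 2 ≤ 1 / (100 * N) := by
  have hN : (0 : ℝ) < N := by exact_mod_cast h.N_pos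
  have hτ := h.tau_pos
  have := h.scale
  rw [div_pow, ← mul_div_assoc, div_le_div_iff₀ (by positivity) (by positivity)]
  nlinarith

lemma sq_ratio_le' (h : LinkBound f Ct τ Λ N) : (N : ℝ) * (Ct * Λ / τ) ^ 2 ≤ 1 / 100 := by
  have hN : (1 : ℝ) ≤ N := by exact_mod_cast h.N_pos
  refine h.sq_ratio_le.trans ?_
  gcongr
  linarith

lemma abs_signedKernel_le (h : LinkBound f Ct τ Λ N) (y x : ℝ) :
    |signedKernel 1 (linkDensity f τ) N y x| ≤
      10 * (growthFactor τ x * wideGauss (y - f (x / τ))) := by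
  have hg := growthFactor_nonneg τ x
  have hw := wideGauss_pos (y - f (x / τ))
  rw [signedKernel_one_eq]
  have hterm : ∀ k ∈ Finset.range (N + 1),
      |(-1 / 2 : ℝ) ^ k / (Nat.factorial k : ℝ) * linkDeriv f τ (2 * k) y x| ≤
        ((N : ℝ) * (Ct * Λ / τ) ^ 2) ^ k * (5 * (growthFactor τ x * wideGauss (y - f (x / τ)))) := by
    intro k hk
    have hk : k ≤ N := Nat.lt_succ_iff.mp (Finset.mem_range.mp hk)
    rw [abs_mul, abs_signedKernel_coeff]
    calc _ ≤ 1 / (2 ^ k * (Nat.factorial k : ℝ)) * ((Nat.factorial (2 * k) : ℝ) *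
          (Ct * Λ / τ) ^ (2 * k) * (growthFactor τ x * (5 * wideGauss (y - f (x / τ))))) :=
          mul_le_mul_of_nonneg_left (h.abs_linkDeriv_le (by omega) y x) (by positivity)
      _ = ((Nat.factorial (2 * k) : ℝ) / (2 ^ k * (Nat.factorial k : ℝ)) *
          (Ct * Λ / τ) ^ (2 * k)) * (5 * (growthFactor τ x * wideGauss (y - f (x / τ)))) := by ring
      _ ≤ _ := mul_le_mul_of_nonneg_right (factorial_two_mul_div_mul_pow_le hk _) (by positivity)
  refine (Finset.abs_sum_le_sum_abs _ _).trans ((Finset.sum_le_sum hterm).trans ?_)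
  rw [← Finset.sum_mul]
  have hsum := geom_sum_le_of_le (by positivity) h.sq_ratio_le' (N + 1)
  have hgw : 0 ≤ growthFactor τ x * wideGauss (y - f (x / τ)) := by positivity
  calc _ ≤ 100 / 99 * (5 * (growthFactor τ x * wideGauss (y - f (x / τ)))) :=
        mul_le_mul_of_nonneg_right hsum (by positivity)
    _ ≤ _ := by linarith

lemma abs_sum_testDeriv_sub_le (h : LinkBound f Ct τ Λ N) {χ : ℝ → ℝ} (hχ : Measurable χ)
    (hχ1 : ∀ y, |χ y| ≤ 1) {θ : ℝ} (hθ : 8 * θ ^ 2 ≤ τ ^ 2) :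
    |∑ k ∈ Finset.range (N + 1), (-1 / 2 : ℝ) ^ k / (Nat.factorial k : ℝ) *
        (∫ x, testDeriv f τ χ (2 * k) x * srcDensity 1 θ x) - testDeriv f τ χ 0 θ| ≤
      90 * Real.exp (-Real.sqrt N) := by
  obtain ⟨M, rfl⟩ : ∃ M, N = M + 1 := ⟨N - 1, by have := h.N_pos; omega⟩
  have hM : (0 : ℝ) ≤ M := M.cast_nonneg
  have hr := h.sq_ratio_le
  set a := Ct * Λ / τ with ha
  have hB := (h.gaussianGrowth hχ hχ1).abs_heat_inversion_sub_le (N := M) le_rfl θ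
    (B := (Nat.factorial (2 * (M + 1)) : ℝ) * a ^ (2 * (M + 1)) * 30)
    fun s hs => h.abs_integral_testDeriv_le hχ1 hθ (abs_le.mpr ⟨by linarith [hs.1], hs.2⟩)
  simp only [integral_mul_srcDensity]
  refine hB.trans ?_
  push_cast at hr
  have h1 := factorial_two_mul_div_mul_pow_le (le_refl (M + 1)) a
  push_cast at h1
  set r := ((M : ℝ) + 1) * a ^ 2 with hrdef
  have hr0 : 0 ≤ r := by positivity
  have h2 : (2 * (M : ℝ) + 3) * r ^ (M + 1) ≤ (3 / 100) * (1 / 100) ^ M := by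
    rw [pow_succ]
    have h3 : r ≤ 1 / 100 := hr.trans (by gcongr; linarith)
    have h4 : (2 * (M : ℝ) + 3) * r ≤ 3 / 100 := by
      rw [le_div_iff₀ (by positivity)] at hr
      nlinarith
    calc (2 * (M : ℝ) + 3) * (r ^ M * r) = ((2 * (M : ℝ) + 3) * r) * r ^ M := by ring
      _ ≤ (3 / 100) * (1 / 100) ^ M := by gcongr
  have h5 : (1 / 100 : ℝ) ^ M ≤ Real.exp (-M) := by
    rw [Real.exp_neg, ← Real.exp_one_pow, one_div, inv_pow]
    gcongr
    linarith [Real.exp_one_lt_d9]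
  have h6 : Real.exp (-(M : ℝ)) ≤ 3 * Real.exp (-Real.sqrt ((M : ℝ) + 1)) := by
    have h7 : Real.sqrt ((M : ℝ) + 1) ≤ M + 1 := by
      rw [Real.sqrt_le_left (by positivity)]
      nlinarith
    calc _ ≤ Real.exp (1 + -Real.sqrt ((M : ℝ) + 1)) := Real.exp_le_exp.mpr (by linarith)
      _ ≤ _ := by
        rw [Real.exp_add]
        gcongr
        linarith [Real.exp_one_lt_d9]
  push_cast
  calc _ = 30 * ((2 * (M : ℝ) + 3) * ((Nat.factorial (2 * (M + 1)) : ℝ) /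
        (2 ^ (M + 1) * (Nat.factorial (M + 1) : ℝ)) * a ^ (2 * (M + 1)))) := by ring
    _ ≤ 30 * ((2 * (M : ℝ) + 3) * r ^ (M + 1)) := by gcongr
    _ ≤ 30 * (3 * Real.exp (-Real.sqrt ((M : ℝ) + 1))) :=
        mul_le_mul_of_nonneg_left (h2.trans (by linarith [Real.exp_pos (-(M : ℝ))])) (by norm_num)
    _ = _ := by ring

end LinkBound

lemma continuous_srcDensity_one (θ : ℝ) : Continuous (srcDensity 1 θ) := by
  unfold srcDensity; fun_prop

lemma srcDensity_one_pos (θ x : ℝ) : 0 < srcDensity 1 θ x := by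
  rw [srcDensity_one]; exact stdGauss_pos _

lemma integrable_growthFactor_mul_srcDensity (τ θ : ℝ) :
    Integrable (fun x => growthFactor τ x * srcDensity 1 θ x) := by
  rw [integrable_mul_srcDensity_iff]
  simpa using integrable_growthFactor (s := 1) (by simp) τ θ

lemma integrable_prod_wideGauss {f : ℝ → ℝ} (hf : Continuous f) (τ θ : ℝ) :
    Integrable (fun p : ℝ × ℝ =>
      growthFactor τ p.2 * wideGauss (p.1 - f (p.2 / τ)) * srcDensity 1 θ p.2)
      (volume.prod volume) := by
  have hg := continuous_growthFactor τ
  have hw := continuous_wideGauss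
  have hs := continuous_srcDensity_one θ
  have hc : Continuous (fun p : ℝ × ℝ =>
      growthFactor τ p.2 * wideGauss (p.1 - f (p.2 / τ)) * srcDensity 1 θ p.2) := by fun_prop
  rw [integrable_prod_iff' hc.aestronglyMeasurable]
  refine ⟨ae_of_all _ fun x =>
    ((integrable_wideGauss_sub (f (x / τ))).const_mul (growthFactor τ x)).mul_const
      (srcDensity 1 θ x), ?_⟩
  have : ∀ x, ∫ y, ‖growthFactor τ x * wideGauss (y - f (x / τ)) * srcDensity 1 θ x‖ =
      (∫ y, wideGauss y) * (growthFactor τ x * srcDensity 1 θ x) := by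
    intro x
    rw [← integral_sub_right_eq_self wideGauss (f (x / τ)), ← integral_mul_const]
    refine integral_congr_ae (ae_of_all _ fun y => ?_)
    have h1 := growthFactor_nonneg τ x
    have h2 := wideGauss_pos (y - f (x / τ))
    have h3 := srcDensity_one_pos θ x
    simp only
    rw [Real.norm_of_nonneg (by positivity)]
    ring
  simp only [this]
  exact (integrable_growthFactor_mul_srcDensity τ θ).const_mul _

lemma integrable_prod_mul_srcDensity {f : ℝ → ℝ} (hf : Continuous f) {τ c : ℝ} {g : ℝ × ℝ → ℝ}
    (hg : Measurable g)
    (hb : ∀ y x, |g (y, x)| ≤ c * (growthFactor τ x * wideGauss (y - f (x / τ)))) (θ : ℝ) :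
    Integrable (fun p => g p * srcDensity 1 θ p.2) (volume.prod volume) := by
  refine ((integrable_prod_wideGauss hf τ θ).const_mul c).mono'
    (hg.mul ((continuous_srcDensity_one θ).measurable.comp measurable_snd)).aestronglyMeasurable
    (ae_of_all _ fun p => ?_)
  have hs := srcDensity_one_pos θ p.2
  rw [Real.norm_eq_abs, abs_mul, abs_of_pos hs]
  exact (mul_le_mul_of_nonneg_right (hb p.1 p.2) hs.le).trans_eq (by ring)

lemma integrable_mul_srcDensity_of_abs_le {f : ℝ → ℝ} {τ c y : ℝ} {g : ℝ → ℝ}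
    (hg : Measurable g) (hc : 0 ≤ c)
    (hb : ∀ x, |g x| ≤ c * (growthFactor τ x * wideGauss (y - f (x / τ)))) (θ : ℝ) :
    Integrable (fun x => g x * srcDensity 1 θ x) := by
  refine ((integrable_growthFactor_mul_srcDensity τ θ).const_mul c).mono'
    (hg.mul (continuous_srcDensity_one θ).measurable).aestronglyMeasurable (ae_of_all _ fun x => ?_)
  have hs := srcDensity_one_pos θ x
  have hG := growthFactor_nonneg τ x
  have hw : wideGauss (y - f (x / τ)) ≤ 1 := by
    unfold wideGauss
    refine mul_le_one₀ one_div_sqrt_two_pi_le_one (Real.exp_pos _).le ?_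
    exact Real.exp_le_one_iff.mpr (by nlinarith [sq_nonneg (y - f (x / τ))])
  rw [Real.norm_eq_abs, abs_mul, abs_of_pos hs, ← mul_assoc]
  refine mul_le_mul_of_nonneg_right ((hb x).trans ?_) hs.le
  exact mul_le_mul_of_nonneg_left (mul_le_of_le_one_right hG hw) hc

lemma integral_linkDensity (f : ℝ → ℝ) (τ θ : ℝ) : ∫ y, linkDensity f τ y θ = 1 :=
  (integral_sub_right_eq_self stdGauss (f (θ / τ))).trans integral_stdGauss

lemma continuous_signedKernel {f : ℝ → ℝ} (hf : ContDiff ℝ (⊤ : ℕ∞) f) (τ : ℝ) (N : ℕ) :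
    Continuous (fun p : ℝ × ℝ => signedKernel 1 (linkDensity f τ) N p.1 p.2) := by
  simp only [signedKernel_one_eq]
  exact continuous_finsetSum _ fun k _ => (continuous_linkDeriv hf τ (2 * k)).const_mul _

lemma exists_measurable_mul_eq_abs {g : ℝ → ℝ} (hg : Measurable g) :
    ∃ χ : ℝ → ℝ, Measurable χ ∧ (∀ y, |χ y| ≤ 1) ∧ ∀ y, χ y * g y = |g y| := by
  refine ⟨fun y => if 0 ≤ g y then 1 else -1,
    Measurable.ite (hg measurableSet_Ici) measurable_const measurable_const, fun y => ?_,
    fun y => ?_⟩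
  · dsimp only
    split_ifs <;> simp
  · dsimp only
    split_ifs with h
    · rw [one_mul, abs_of_nonneg h]
    · rw [abs_of_neg (not_le.mp h)]
      ring

namespace LinkBound

variable {f : ℝ → ℝ} {Ct τ Λ : ℝ} {N : ℕ}

lemma integral_testDeriv_mul_srcDensity (h : LinkBound f Ct τ Λ N) {χ : ℝ → ℝ}
    (hχ : Measurable χ) (hχ1 : ∀ y, |χ y| ≤ 1) {n : ℕ} (hn : n ≤ 2 * N) (θ : ℝ) :
    Integrable (fun y => χ y * ∫ x, linkDeriv f τ n y x * srcDensity 1 θ x) ∧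
    ∫ x, testDeriv f τ χ n x * srcDensity 1 θ x =
      ∫ y, χ y * ∫ x, linkDeriv f τ n y x * srcDensity 1 θ x := by
  have hm : Measurable (fun p : ℝ × ℝ => χ p.1 * linkDeriv f τ n p.1 p.2) :=
    (hχ.comp measurable_fst).mul (continuous_linkDeriv h.smooth τ n).measurable
  have hint := integrable_prod_mul_srcDensity (τ := τ) h.smooth.continuous
    (c := (Nat.factorial n : ℝ) * (Ct * Λ / τ) ^ n * 5) hm (fun y x => by
      rw [abs_mul]
      refine (mul_le_of_le_one_left (abs_nonneg _) (hχ1 y)).trans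
        ((h.abs_linkDeriv_le hn y x).trans_eq (by ring))) θ
  have hE : ∀ y, ∫ x, χ y * linkDeriv f τ n y x * srcDensity 1 θ x =
      χ y * ∫ x, linkDeriv f τ n y x * srcDensity 1 θ x := by
    intro y
    rw [← integral_const_mul]
    simp only [mul_assoc]
  refine ⟨?_, ?_⟩
  · have := hint.integral_prod_left
    simpa only [hE] using this
  · have := integral_integral_swap (f := fun y x => χ y * linkDeriv f τ n y x * srcDensity 1 θ x)
      hint
    simp only [hE] at this
    rw [this]
    refine integral_congr_ae (ae_of_all _ fun x => ?_)
    simp only [testDeriv]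
    rw [integral_mul_const]

lemma integral_signedKernel_mul_srcDensity (h : LinkBound f Ct τ Λ N) (y θ : ℝ) :
    ∫ x, signedKernel 1 (linkDensity f τ) N y x * srcDensity 1 θ x =
      ∑ k ∈ Finset.range (N + 1), (-1 / 2 : ℝ) ^ k / (Nat.factorial k : ℝ) *
        ∫ x, linkDeriv f τ (2 * k) y x * srcDensity 1 θ x := by
  have hCt := h.Ct_pos
  have hτ := h.tau_pos
  have hΛ := h.one_le
  simp only [signedKernel_one_eq, Finset.sum_mul]
  rw [integral_finsetSum]
  · refine Finset.sum_congr rfl fun k _ => ?_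
    rw [← integral_const_mul]
    simp only [mul_assoc]
  · intro k hk
    have hk : k ≤ N := Nat.lt_succ_iff.mp (Finset.mem_range.mp hk)
    simp only [mul_assoc]
    refine Integrable.const_mul ?_ _
    have hm : Measurable (fun x => linkDeriv f τ (2 * k) y x) := by
      have := (continuous_linkDeriv h.smooth τ (2 * k)).measurable
      generalize linkDeriv f τ (2 * k) = g at this ⊢
      fun_prop
    refine integrable_mul_srcDensity_of_abs_le (f := f) (τ := τ) (y := y)
      (c := (Nat.factorial (2 * k) : ℝ) * (Ct * Λ / τ) ^ (2 * k) * 5) hm (by positivity)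
      (fun x => (h.abs_linkDeriv_le (by omega) y x).trans_eq (by ring)) θ

lemma integral_abs_signedKernel_sub_le (h : LinkBound f Ct τ Λ N) {θ : ℝ}
    (hθ : 8 * θ ^ 2 ≤ τ ^ 2) :
    Integrable (fun y => (∫ x, signedKernel 1 (linkDensity f τ) N y x * srcDensity 1 θ x) -
      linkDensity f τ y θ) ∧
    ∫ y, |(∫ x, signedKernel 1 (linkDensity f τ) N y x * srcDensity 1 θ x) -
      linkDensity f τ y θ| ≤ 90 * Real.exp (-Real.sqrt N) := by
  set e : ℝ → ℝ := fun y => (∫ x, signedKernel 1 (linkDensity f τ) N y x * srcDensity 1 θ x) -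
      linkDensity f τ y θ with he
  have hem : Measurable e := by
    refine Measurable.sub ?_ ?_
    · have : StronglyMeasurable (fun p : ℝ × ℝ =>
          signedKernel 1 (linkDensity f τ) N p.1 p.2 * srcDensity 1 θ p.2) :=
        ((continuous_signedKernel h.smooth τ N).mul
          ((continuous_srcDensity_one θ).comp continuous_snd)).stronglyMeasurable
      exact (this.integral_prod_right (ν := volume)).measurable
    · exact (continuous_linkDeriv_left h.smooth τ 0 θ).measurable
  obtain ⟨χ, hχ, hχ1, hχe⟩ := exists_measurable_mul_eq_abs hem
  have hk : ∀ k ∈ Finset.range (N + 1), 2 * k ≤ 2 * N := fun k hk => by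
    have := Finset.mem_range.mp hk
    omega
  have hexp : ∀ ψ : ℝ → ℝ, (fun y => ψ y * e y) = fun y => (∑ k ∈ Finset.range (N + 1),
      (-1 / 2 : ℝ) ^ k / (Nat.factorial k : ℝ) *
        (ψ y * ∫ x, linkDeriv f τ (2 * k) y x * srcDensity 1 θ x)) - ψ y * linkDeriv f τ 0 y θ := by
    intro ψ
    ext y
    rw [he]
    simp only
    rw [h.integral_signedKernel_mul_srcDensity y θ, mul_sub, Finset.mul_sum]
    congr 1
    exact Finset.sum_congr rfl fun k _ => by ring
  have hint : ∀ ψ : ℝ → ℝ, Measurable ψ → (∀ y, |ψ y| ≤ 1) →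
      Integrable (fun y => ∑ k ∈ Finset.range (N + 1), (-1 / 2 : ℝ) ^ k / (Nat.factorial k : ℝ) *
        (ψ y * ∫ x, linkDeriv f τ (2 * k) y x * srcDensity 1 θ x)) := fun ψ h1 h2 =>
    integrable_finsetSum _ fun k hk' =>
      (h.integral_testDeriv_mul_srcDensity h1 h2 (hk k hk') θ).1.const_mul _
  constructor
  · have h1 : (fun y => (1 : ℝ) * e y) = e := by simp
    rw [← h1, hexp (fun _ => 1)]
    exact (hint _ measurable_const (by simp)).sub
      (integrable_mul_linkDeriv h.smooth h.tau_pos measurable_const (by simp) 0 θ)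
  · have h1 : ∫ y, |e y| = ∑ k ∈ Finset.range (N + 1), (-1 / 2 : ℝ) ^ k / (Nat.factorial k : ℝ) *
        (∫ x, testDeriv f τ χ (2 * k) x * srcDensity 1 θ x) - testDeriv f τ χ 0 θ := by
      simp only [← hχe]
      rw [hexp χ, integral_sub (hint χ hχ hχ1)
        (integrable_mul_linkDeriv h.smooth h.tau_pos hχ hχ1 0 θ), integral_finsetSum _ fun k hk' =>
        (h.integral_testDeriv_mul_srcDensity hχ hχ1 (hk k hk') θ).1.const_mul _]
      congr 1
      refine Finset.sum_congr rfl fun k hk' => ?_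
      rw [integral_const_mul, (h.integral_testDeriv_mul_srcDensity hχ hχ1 (hk k hk') θ).2]
    rw [h1]
    exact (le_abs_self _).trans (h.abs_sum_testDeriv_sub_le hχ hχ1 hθ)

end LinkBound

lemma testDeriv_one_zero (f : ℝ → ℝ) (τ x : ℝ) : testDeriv f τ (fun _ => 1) 0 x = 1 := by
  simp only [testDeriv, linkDeriv, iteratedDeriv_zero, one_mul]
  exact integral_linkDensity f τ x

lemma testDeriv_one_succ {f : ℝ → ℝ} (hf : ContDiff ℝ (⊤ : ℕ∞) f) {τ : ℝ} (hτ : 0 < τ) (n : ℕ)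
    (x : ℝ) : testDeriv f τ (fun _ => 1) (n + 1) x = 0 := by
  induction n generalizing x with
  | zero =>
    have h := hasDerivAt_testDeriv hf hτ (χ := fun _ => 1) measurable_const (by simp) 0 x
    have h0 : testDeriv f τ (fun _ => 1) 0 = fun _ => 1 := funext (testDeriv_one_zero f τ)
    rw [h0] at h
    exact h.unique (hasDerivAt_const x 1)
  | succ n ih =>
    have h := hasDerivAt_testDeriv hf hτ (χ := fun _ => 1) measurable_const (by simp) (n + 1) x
    have h0 : testDeriv f τ (fun _ => 1) (n + 1) = fun _ => 0 := funext ih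
    rw [h0] at h
    exact h.unique (hasDerivAt_const x 0)

lemma integrable_signedKernel {f : ℝ → ℝ} (hf : ContDiff ℝ (⊤ : ℕ∞) f) {τ : ℝ} (hτ : 0 < τ)
    (N : ℕ) (x : ℝ) : Integrable (fun y => signedKernel 1 (linkDensity f τ) N y x) := by
  simp only [signedKernel_one_eq]
  refine integrable_finsetSum _ fun k _ => Integrable.const_mul ?_ _
  simpa using integrable_mul_linkDeriv hf hτ (χ := fun _ => 1) measurable_const (by simp) (2 * k) x

lemma integral_signedKernel {f : ℝ → ℝ} (hf : ContDiff ℝ (⊤ : ℕ∞) f) {τ : ℝ} (hτ : 0 < τ)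
    (N : ℕ) (x : ℝ) : ∫ y, signedKernel 1 (linkDensity f τ) N y x = 1 := by
  have hint : ∀ k, Integrable (fun y => linkDeriv f τ k y x) := fun k => by
    simpa using integrable_mul_linkDeriv hf hτ (χ := fun _ => 1) measurable_const (by simp) k x
  have heq : ∀ k, ∫ y, linkDeriv f τ k y x = testDeriv f τ (fun _ => 1) k x := fun k => by
    simp [testDeriv]
  simp only [signedKernel_one_eq]
  rw [integral_finsetSum _ fun k _ => (hint (2 * k)).const_mul _, Finset.sum_range_succ']
  simp only [integral_const_mul, heq, mul_zero, testDeriv_one_zero, mul_add, mul_one,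
    testDeriv_one_succ hf hτ]
  simp

lemma pFun_eq_one_add_qFun {f : ℝ → ℝ} (hf : ContDiff ℝ (⊤ : ℕ∞) f) {τ : ℝ} (hτ : 0 < τ)
    (N : ℕ) (x : ℝ) : pFun 1 (linkDensity f τ) N x = 1 + qFun 1 (linkDensity f τ) N x := by
  have hS := integrable_signedKernel hf hτ N x
  have h : ∫ y, (max (signedKernel 1 (linkDensity f τ) N y x) 0 +
      min (signedKernel 1 (linkDensity f τ) N y x) 0) = 1 := by
    simp only [max_add_min, add_zero]
    exact integral_signedKernel hf hτ N x
  have hmin : Integrable (fun y => min (signedKernel 1 (linkDensity f τ) N y x) 0) :=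
    hS.inf (integrable_zero _ _ _)
  rw [integral_add hS.pos_part hmin] at h
  unfold pFun qFun
  linarith

lemma qFun_nonneg (f : ℝ → ℝ) (τ : ℝ) (N : ℕ) (x : ℝ) : 0 ≤ qFun 1 (linkDensity f τ) N x :=
  neg_nonneg.mpr (integral_nonpos fun _ => min_le_right _ _)

namespace LinkBound

variable {f : ℝ → ℝ} {Ct τ Λ : ℝ} {N : ℕ}

lemma linkDensity_sub_le_signedKernel (h : LinkBound f Ct τ Λ N) {x : ℝ} (hx : |x| ≤ τ) (y : ℝ) :
    linkDensity f τ y x - 1 / 99 * ((1 / Real.sqrt (2 * Real.pi)) *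
      Real.exp (-(y - f (x / τ)) ^ 2 / 2 + |y - f (x / τ)| / Real.sqrt N + 1 / 2)) ≤
    signedKernel 1 (linkDensity f τ) N y x := by
  have hCt := h.Ct_pos
  have hτ := h.tau_pos
  have hΛ := h.one_le
  have hN : (1 : ℝ) ≤ N := by exact_mod_cast h.N_pos
  set G := (1 / Real.sqrt (2 * Real.pi)) *
      Real.exp (-(y - f (x / τ)) ^ 2 / 2 + |y - f (x / τ)| / Real.sqrt N + 1 / 2) with hG
  have hG0 : 0 ≤ G := by positivity
  set a := Ct * (Λ * Real.sqrt N) / τ with ha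
  have hr : (N : ℝ) * a ^ 2 ≤ 1 / 100 := by
    have := h.scale
    rw [ha, div_pow, mul_pow, mul_pow, Real.sq_sqrt (by positivity), ← mul_div_assoc,
      div_le_div_iff₀ (by positivity) (by positivity)]
    nlinarith
  set r := (N : ℝ) * a ^ 2 with hrdef
  have hr0 : 0 ≤ r := by positivity
  have hterm : ∀ k ∈ Finset.range N, -(r ^ k * (r * G)) ≤
      (-1 / 2 : ℝ) ^ (k + 1) / (Nat.factorial (k + 1) : ℝ) * linkDeriv f τ (2 * (k + 1)) y x := by
    intro k hk
    have hk : k + 1 ≤ N := Finset.mem_range.mp hk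
    refine neg_le_of_abs_le ?_
    rw [abs_mul, abs_signedKernel_coeff]
    have h1 := abs_iteratedDeriv_linkDensity_le h.smooth hCt hτ (y := y) hΛ
      (Real.one_le_sqrt.mpr hN)
      ((derivSumF_mono hCt (by omega : 2 * (k + 1) ≤ 2 * N) _).trans (h.inner x hx))
    rw [mul_assoc _ (1 / Real.sqrt (2 * Real.pi)), ← ha, ← hG] at h1
    calc _ ≤ 1 / (2 ^ (k + 1) * (Nat.factorial (k + 1) : ℝ)) *
          ((Nat.factorial (2 * (k + 1)) : ℝ) * a ^ (2 * (k + 1)) * G) :=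
          mul_le_mul_of_nonneg_left h1 (by positivity)
      _ = ((Nat.factorial (2 * (k + 1)) : ℝ) / (2 ^ (k + 1) * (Nat.factorial (k + 1) : ℝ)) *
          a ^ (2 * (k + 1))) * G := by ring
      _ ≤ r ^ (k + 1) * G :=
          mul_le_mul_of_nonneg_right (factorial_two_mul_div_mul_pow_le hk a) hG0
      _ = _ := by ring
  have hsum := Finset.sum_le_sum hterm
  rw [Finset.sum_neg_distrib, ← Finset.sum_mul] at hsum
  have hgeo := geom_sum_le_of_le hr0 hr N
  have hle : (∑ k ∈ Finset.range N, r ^ k) * (r * G) ≤ 1 / 99 * G := by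
    calc _ ≤ 100 / 99 * (1 / 100 * G) := by gcongr
      _ = _ := by ring
  have h0 : (-1 / 2 : ℝ) ^ 0 / (Nat.factorial 0 : ℝ) * linkDeriv f τ (2 * 0) y x =
      linkDensity f τ y x := by
    simp [linkDeriv]
  rw [signedKernel_one_eq, Finset.sum_range_succ', h0]
  linarith

lemma neg_signedKernel_le (h : LinkBound f Ct τ Λ N) (y x : ℝ) :
    max (-signedKernel 1 (linkDensity f τ) N y x) 0 ≤
      125 * (Real.exp (-Real.sqrt N) + Real.exp (x ^ 2 / 6 - τ ^ 2 / 24)) *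
        wideGauss (y - f (x / τ)) := by
  have hN : (1 : ℝ) ≤ N := by exact_mod_cast h.N_pos
  have hw := wideGauss_pos (y - f (x / τ))
  refine max_le ?_ (by positivity)
  rcases le_total |x| τ with hx | hx
  · have hS := h.linkDensity_sub_le_signedKernel hx y
    rw [show linkDensity f τ y x = (1 / Real.sqrt (2 * Real.pi)) *
      Real.exp (-(y - f (x / τ)) ^ 2 / 2) from rfl] at hS
    set z := y - f (x / τ) with hz
    set c := 1 / Real.sqrt (2 * Real.pi) with hc
    have hc0 : 0 < c := by positivity
    have hsq : 1 ≤ Real.sqrt N := Real.one_le_sqrt.mpr hN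
    rcases le_total |z| (Real.sqrt N) with hz1 | hz1
    · have h1 : Real.exp (-z ^ 2 / 2 + |z| / Real.sqrt N + 1 / 2) ≤ 5 * Real.exp (-z ^ 2 / 2) := by
        have : |z| / Real.sqrt N ≤ 1 := (div_le_one (by positivity)).mpr hz1
        calc _ ≤ Real.exp (3 / 2 + -z ^ 2 / 2) := Real.exp_le_exp.mpr (by linarith)
          _ ≤ _ := by
            rw [Real.exp_add]
            exact mul_le_mul_of_nonneg_right exp_three_halves_le (Real.exp_pos _).le
      have h2 := mul_le_mul_of_nonneg_left h1 hc0.le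
      have h3 : 0 ≤ c * Real.exp (-z ^ 2 / 2) := by positivity
      have h4 : 0 ≤ 125 * (Real.exp (-Real.sqrt N) + Real.exp (x ^ 2 / 6 - τ ^ 2 / 24)) *
        wideGauss z := by positivity
      linarith
    · have h1 : c * Real.exp (-z ^ 2 / 2 + |z| / Real.sqrt N + 1 / 2) ≤
          Real.exp (-Real.sqrt N) * (125 * wideGauss z) := by
        have hdiv : |z| / Real.sqrt N ≤ |z| := div_le_self (abs_nonneg z) hsq
        calc _ ≤ c * Real.exp (-Real.sqrt N + (-z ^ 2 / 2 + 2 * |z| + 1 / 2)) := by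
              refine mul_le_mul_of_nonneg_left (Real.exp_le_exp.mpr (by linarith)) hc0.le
          _ = Real.exp (-Real.sqrt N) * (c * Real.exp (-z ^ 2 / 2 + 2 * |z| + 1 / 2)) := by
              rw [Real.exp_add]; ring
          _ ≤ _ := mul_le_mul_of_nonneg_left (gauss_exp_two_abs_le_wideGauss z) (Real.exp_pos _).le
      have h3 : 0 ≤ c * Real.exp (-z ^ 2 / 2) := by positivity
      have h4 : 0 ≤ Real.exp (x ^ 2 / 6 - τ ^ 2 / 24) * wideGauss z := by positivity
      have h5 : 0 ≤ Real.exp (-Real.sqrt N) * (125 * wideGauss z) := by positivity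
      linarith
  · have hx2 : τ ^ 2 ≤ x ^ 2 := by
      rw [← sq_abs x]
      exact pow_le_pow_left₀ h.tau_pos.le hx 2
    have h1 : growthFactor τ x ≤ 2 * Real.exp (x ^ 2 / 6 - τ ^ 2 / 24) := by
      have : 1 ≤ Real.exp (x ^ 2 / 6 - τ ^ 2 / 24) :=
        Real.one_le_exp (by linarith [sq_nonneg τ])
      unfold growthFactor
      linarith
    have h2 := mul_le_mul_of_nonneg_right h1 hw.le
    have h3 := (neg_le_abs _).trans (h.abs_signedKernel_le y x)
    have h4 : 0 ≤ Real.exp (x ^ 2 / 6 - τ ^ 2 / 24) * wideGauss (y - f (x / τ)) := by positivity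
    have h5 : 0 ≤ Real.exp (-Real.sqrt N) * wideGauss (y - f (x / τ)) := by positivity
    linarith

lemma qFun_le (h : LinkBound f Ct τ Λ N) (x : ℝ) :
    qFun 1 (linkDensity f τ) N x ≤
      250 * (Real.exp (-Real.sqrt N) + Real.exp (x ^ 2 / 6 - τ ^ 2 / 24)) := by
  unfold qFun
  rw [← integral_neg]
  have hS := integrable_signedKernel h.smooth h.tau_pos N x
  calc _ ≤ ∫ y, 125 * (Real.exp (-Real.sqrt N) + Real.exp (x ^ 2 / 6 - τ ^ 2 / 24)) *
        wideGauss (y - f (x / τ)) := by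
        refine integral_mono (hS.inf (integrable_zero _ _ _)).neg
          ((integrable_wideGauss_sub _).const_mul _) fun y => ?_
        have := h.neg_signedKernel_le y x
        rwa [← neg_zero, max_neg_neg] at this
    _ ≤ 125 * (Real.exp (-Real.sqrt N) + Real.exp (x ^ 2 / 6 - τ ^ 2 / 24)) * 2 := by
        rw [integral_const_mul]
        exact mul_le_mul_of_nonneg_left (integral_wideGauss_sub_le _) (by positivity)
    _ = _ := by ring

end LinkBound

lemma measurable_markovKernel {f : ℝ → ℝ} (hf : ContDiff ℝ (⊤ : ℕ∞) f) (τ : ℝ) (N : ℕ) :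
    Measurable (fun p : ℝ × ℝ => markovKernel 1 (linkDensity f τ) N p.1 p.2) := by
  have hc : Continuous (fun p : ℝ × ℝ => max (signedKernel 1 (linkDensity f τ) N p.1 p.2) 0) :=
    (continuous_signedKernel hf τ N).max continuous_const
  have hp : Measurable (pFun 1 (linkDensity f τ) N) :=
    (hc.stronglyMeasurable.integral_prod_left' (μ := volume)).measurable
  exact hc.measurable.div (hp.comp measurable_snd)

lemma one_le_pFun {f : ℝ → ℝ} (hf : ContDiff ℝ (⊤ : ℕ∞) f) {τ : ℝ} (hτ : 0 < τ) (N : ℕ) (x : ℝ) :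
    1 ≤ pFun 1 (linkDensity f τ) N x := by
  rw [pFun_eq_one_add_qFun hf hτ]
  linarith [qFun_nonneg f τ N x]

lemma markovKernel_nonneg {f : ℝ → ℝ} (hf : ContDiff ℝ (⊤ : ℕ∞) f) {τ : ℝ} (hτ : 0 < τ) (N : ℕ)
    (y x : ℝ) : 0 ≤ markovKernel 1 (linkDensity f τ) N y x :=
  div_nonneg (le_max_right _ _) (zero_le_one.trans (one_le_pFun hf hτ N x))

lemma markovKernel_le {f : ℝ → ℝ} (hf : ContDiff ℝ (⊤ : ℕ∞) f) {τ : ℝ} (hτ : 0 < τ) (N : ℕ)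
    (y x : ℝ) : markovKernel 1 (linkDensity f τ) N y x ≤
      max (signedKernel 1 (linkDensity f τ) N y x) 0 :=
  div_le_self (le_max_right _ _) (one_le_pFun hf hτ N x)

lemma abs_markovKernel_sub_eq {f : ℝ → ℝ} (hf : ContDiff ℝ (⊤ : ℕ∞) f) {τ : ℝ} (hτ : 0 < τ)
    (N : ℕ) (y x : ℝ) :
    |markovKernel 1 (linkDensity f τ) N y x - signedKernel 1 (linkDensity f τ) N y x| =
      (max (signedKernel 1 (linkDensity f τ) N y x) 0 - markovKernel 1 (linkDensity f τ) N y x) -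
        min (signedKernel 1 (linkDensity f τ) N y x) 0 := by
  have h1 := markovKernel_le hf hτ N y x
  have h2 := markovKernel_nonneg hf hτ N y x
  rcases le_total (signedKernel 1 (linkDensity f τ) N y x) 0 with h | h
  · rw [max_eq_right h] at h1 ⊢
    rw [min_eq_left h, abs_of_nonneg (by linarith)]
    linarith
  · rw [max_eq_left h] at h1 ⊢
    rw [min_eq_right h, abs_of_nonpos (by linarith)]
    ring

lemma integral_abs_markovKernel_sub {f : ℝ → ℝ} (hf : ContDiff ℝ (⊤ : ℕ∞) f) {τ : ℝ}
    (hτ : 0 < τ) (N : ℕ) (x : ℝ) :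
    ∫ y, |markovKernel 1 (linkDensity f τ) N y x - signedKernel 1 (linkDensity f τ) N y x| =
      2 * qFun 1 (linkDensity f τ) N x := by
  have hS := integrable_signedKernel hf hτ N x
  have hmax : Integrable (fun y => max (signedKernel 1 (linkDensity f τ) N y x) 0) := hS.pos_part
  have hmin : Integrable (fun y => min (signedKernel 1 (linkDensity f τ) N y x) 0) :=
    hS.inf (integrable_zero _ _ _)
  have hT : Integrable (fun y => markovKernel 1 (linkDensity f τ) N y x) := hmax.div_const _
  have hp := one_le_pFun hf hτ N x
  have hT1 : ∫ y, markovKernel 1 (linkDensity f τ) N y x = 1 := by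
    unfold markovKernel
    rw [integral_div]
    exact div_self (zero_lt_one.trans_le hp).ne'
  have hp1 := pFun_eq_one_add_qFun hf hτ N x
  simp only [abs_markovKernel_sub_eq hf hτ]
  have hmaxT : Integrable (fun y => max (signedKernel 1 (linkDensity f τ) N y x) 0 -
    markovKernel 1 (linkDensity f τ) N y x) := hmax.sub hT
  rw [integral_sub hmaxT hmin, integral_sub hmax hT, hT1]
  unfold pFun at hp1
  rw [hp1]
  unfold qFun
  ring

namespace LinkBound

variable {f : ℝ → ℝ} {Ct τ Λ : ℝ} {N : ℕ}

lemma integral_growth_mul_srcDensity_le (h : LinkBound f Ct τ Λ N) (hN : 100 * (N : ℝ) ^ 2 ≤ τ ^ 2)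
    {θ : ℝ} (hθ : 16 * θ ^ 2 ≤ τ ^ 2) :
    Integrable (fun x => (Real.exp (-Real.sqrt N) + Real.exp (x ^ 2 / 6 - τ ^ 2 / 24)) *
      srcDensity 1 θ x) ∧
    ∫ x, (Real.exp (-Real.sqrt N) + Real.exp (x ^ 2 / 6 - τ ^ 2 / 24)) * srcDensity 1 θ x ≤
      3 * Real.exp (-Real.sqrt N) := by
  have hN1 : (1 : ℝ) ≤ N := by exact_mod_cast h.N_pos
  have hsq : Real.sqrt N ≤ N := by
    rw [Real.sqrt_le_left (by positivity)]
    nlinarith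
  have hexp : ∀ x, (Real.exp (-Real.sqrt N) + Real.exp ((θ + x) ^ 2 / 6 - τ ^ 2 / 24)) * stdGauss x
      = Real.exp (-Real.sqrt N) * stdGauss x +
        Real.exp (-(τ ^ 2 / 24)) * (Real.exp ((θ + 1 * x) ^ 2 / 6) * stdGauss x) := by
    intro x
    rw [sub_eq_add_neg, Real.exp_add, one_mul]
    ring
  have h1 := integrable_stdGauss.const_mul (Real.exp (-Real.sqrt N))
  have h2 := (integrable_exp_mul_stdGauss (s := 1) (by norm_num) θ).const_mul
    (Real.exp (-(τ ^ 2 / 24)))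
  refine ⟨?_, ?_⟩
  · rw [integrable_mul_srcDensity_iff]
    simp only [hexp]
    exact h1.add h2
  · rw [integral_mul_srcDensity]
    simp only [hexp]
    rw [integral_add h1 h2, integral_const_mul, integral_const_mul, integral_stdGauss]
    have h3 : Real.exp (-(τ ^ 2 / 24)) * Real.exp (θ ^ 2 / 3) ≤ Real.exp (-Real.sqrt N) := by
      rw [← Real.exp_add]
      exact Real.exp_le_exp.mpr (by nlinarith)
    have h4 := mul_le_mul_of_nonneg_left (integral_exp_mul_stdGauss_le (s := 1) (by norm_num) θ)
      (Real.exp_pos (-(τ ^ 2 / 24))).le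
    linarith

lemma deficiency_le (h : LinkBound f Ct τ Λ N) (hN : 100 * (N : ℝ) ^ 2 ≤ τ ^ 2)
    {θ : ℝ} (hθ : 16 * θ ^ 2 ≤ τ ^ 2) :
    (1 / 2) * ∫ y, |(∫ x, markovKernel 1 (linkDensity f τ) N y x * srcDensity 1 θ x) -
      linkDensity f τ y θ| ≤ 795 * Real.exp (-Real.sqrt N) := by
  have hf := h.smooth
  have hτ := h.tau_pos
  set S : ℝ → ℝ → ℝ := signedKernel 1 (linkDensity f τ) N with hS
  set T : ℝ → ℝ → ℝ := markovKernel 1 (linkDensity f τ) N with hT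
  set u := srcDensity 1 θ with hu
  have hSm : Measurable (fun p : ℝ × ℝ => S p.1 p.2) := (continuous_signedKernel hf τ N).measurable
  have hTm : Measurable (fun p : ℝ × ℝ => T p.1 p.2) := measurable_markovKernel hf τ N
  have hSb : ∀ y x, |S y x| ≤ 10 * (growthFactor τ x * wideGauss (y - f (x / τ))) :=
    h.abs_signedKernel_le
  have hTb : ∀ y x, |T y x| ≤ 10 * (growthFactor τ x * wideGauss (y - f (x / τ))) := by
    intro y x
    rw [abs_of_nonneg (markovKernel_nonneg hf hτ N y x)]
    exact (markovKernel_le hf hτ N y x).trans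
      ((max_le (le_abs_self _) (abs_nonneg _)).trans (hSb y x))
  have hSint : ∀ y, Integrable (fun x => S y x * u x) := fun y =>
    integrable_mul_srcDensity_of_abs_le (f := f) (τ := τ) (y := y)
      (hSm.comp (measurable_const.prodMk measurable_id)) (by norm_num) (hSb y) θ
  have hTint : ∀ y, Integrable (fun x => T y x * u x) := fun y =>
    integrable_mul_srcDensity_of_abs_le (f := f) (τ := τ) (y := y)
      (hTm.comp (measurable_const.prodMk measurable_id)) (by norm_num) (hTb y) θ
  have hD : Integrable (fun p : ℝ × ℝ => |T p.1 p.2 - S p.1 p.2| * u p.2)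
      (volume.prod volume) := by
    refine integrable_prod_mul_srcDensity (τ := τ) (c := 20) hf.continuous (hTm.sub hSm).abs
      (fun y x => ?_) θ
    rw [abs_abs]
    exact (abs_sub _ _).trans (by linarith [hSb y x, hTb y x])
  obtain ⟨he, hle⟩ := h.integral_abs_signedKernel_sub_le (θ := θ) (by nlinarith [sq_nonneg θ])
  have hDy : Integrable (fun y => ∫ x, |T y x - S y x| * u x) := hD.integral_prod_left
  have hpt : ∀ y, |(∫ x, T y x * u x) - linkDensity f τ y θ| ≤
      |(∫ x, S y x * u x) - linkDensity f τ y θ| + ∫ x, |T y x - S y x| * u x := by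
    intro y
    have h1 : |(∫ x, T y x * u x) - ∫ x, S y x * u x| ≤ ∫ x, |T y x - S y x| * u x := by
      rw [← integral_sub (hTint y) (hSint y)]
      refine (abs_integral_le_integral_abs).trans_eq (integral_congr_ae (ae_of_all _ fun x => ?_))
      simp only
      rw [← sub_mul, abs_mul, abs_of_pos (srcDensity_one_pos θ x)]
    have h2 := abs_add_le ((∫ x, S y x * u x) - linkDensity f τ y θ)
      ((∫ x, T y x * u x) - ∫ x, S y x * u x)
    rw [show (∫ x, S y x * u x) - linkDensity f τ y θ + ((∫ x, T y x * u x) - ∫ x, S y x * u x) =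
      (∫ x, T y x * u x) - linkDensity f τ y θ by ring] at h2
    linarith
  have hswap : ∫ y, ∫ x, |T y x - S y x| * u x =
      ∫ x, 2 * qFun 1 (linkDensity f τ) N x * u x := by
    rw [integral_integral_swap (f := fun y x => |T y x - S y x| * u x) hD]
    refine integral_congr_ae (ae_of_all _ fun x => ?_)
    simp only
    rw [integral_mul_const, integral_abs_markovKernel_sub hf hτ]
  have hq : ∫ x, 2 * qFun 1 (linkDensity f τ) N x * u x ≤ 1500 * Real.exp (-Real.sqrt N) := by
    obtain ⟨hi, hl⟩ := h.integral_growth_mul_srcDensity_le hN hθ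
    calc _ ≤ ∫ x, 500 * ((Real.exp (-Real.sqrt N) + Real.exp (x ^ 2 / 6 - τ ^ 2 / 24)) * u x) := by
          refine integral_mono_of_nonneg (ae_of_all _ fun x => ?_) (hi.const_mul 500)
            (ae_of_all _ fun x => ?_)
          · exact mul_nonneg (mul_nonneg zero_le_two (qFun_nonneg f τ N x))
              (srcDensity_one_pos θ x).le
          · simp only
            rw [← mul_assoc]
            exact mul_le_mul_of_nonneg_right (by linarith [h.qFun_le x])
              (srcDensity_one_pos θ x).le
      _ ≤ _ := by
          rw [integral_const_mul]
          linarith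
  have hmain : ∫ y, |(∫ x, T y x * u x) - linkDensity f τ y θ| ≤
      (∫ y, |(∫ x, S y x * u x) - linkDensity f τ y θ|) + ∫ y, ∫ x, |T y x - S y x| * u x := by
    rw [← integral_add he.abs hDy]
    exact integral_mono_of_nonneg (ae_of_all _ fun y => abs_nonneg _) (he.abs.add hDy)
      (ae_of_all _ hpt)
  rw [hswap] at hmain
  linarith

end LinkBound

lemma le_biSup_of_forall_le {S : Set ℝ} {g : ℝ → ℝ} {K : ℝ} (hK : ∀ x ∈ S, g x ≤ K) {x : ℝ}
    (hx : x ∈ S) : g x ≤ ⨆ x ∈ S, g x := by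
  refine le_ciSup_of_le (f := fun x => ⨆ _ : x ∈ S, g x) ⟨max K 0, ?_⟩ x ?_
  · rintro _ ⟨y, rfl⟩
    exact Real.iSup_le (fun hy => (hK y hy).trans (le_max_left _ _)) (le_max_right _ _)
  · exact le_ciSup (f := fun _ : x ∈ S => g x) ⟨K, by rintro _ ⟨hy, rfl⟩; exact hK x hy⟩ hx

lemma abs_iteratedDeriv_le_mul_derivSumF (f : ℝ → ℝ) {Ct : ℝ} (hCt : 0 < Ct) {j n : ℕ}
    (hj : 1 ≤ j) (hjn : j ≤ n) (t : ℝ) :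
    |iteratedDeriv j f t| ≤ Ct ^ j * (Nat.factorial j : ℝ) * derivSumF f Ct n t := by
  rw [← div_le_iff₀' (by positivity)]
  exact Finset.single_le_sum
    (f := fun j => |iteratedDeriv j f t| / (Ct ^ j * (Nat.factorial j : ℝ)))
    (fun i _ => by positivity) (Finset.mem_Icc.mpr ⟨hj, hjn⟩)

/-- A function whose derivative is integrable against `e^{-2t²}` is `O(e^{2t²})`. -/
lemma exists_abs_le_mul_exp_of_integrable {g g' : ℝ → ℝ} (hg : ∀ t, HasDerivAt g (g' t) t)
    (hc : Continuous g') (hi : Integrable (fun t => |g' t| * Real.exp (-(2 * t ^ 2)))) :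
    ∃ K, ∀ t, |g t| ≤ K * Real.exp (2 * t ^ 2) := by
  refine ⟨|g 0| + ∫ t, |g' t| * Real.exp (-(2 * t ^ 2)), fun t => ?_⟩
  have h1 : g t - g 0 = ∫ s in (0 : ℝ)..t, g' s :=
    (intervalIntegral.integral_eq_sub_of_hasDerivAt (fun s _ => hg s)
      (hc.intervalIntegrable 0 t)).symm
  have h2 : |g t - g 0| ≤ Real.exp (2 * t ^ 2) * ∫ s, |g' s| * Real.exp (-(2 * s ^ 2)) := by
    rw [h1, ← Real.norm_eq_abs]
    refine intervalIntegral.norm_integral_le_integral_norm_uIoc.trans ?_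
    calc _ ≤ ∫ s in Set.uIoc 0 t, Real.exp (2 * t ^ 2) * (|g' s| * Real.exp (-(2 * s ^ 2))) := by
          refine setIntegral_mono_on ?_ (hi.const_mul _).integrableOn measurableSet_uIoc
            fun s hs => ?_
          · exact (intervalIntegrable_iff.mp (hc.norm.intervalIntegrable 0 t))
          · have hst : s ^ 2 ≤ t ^ 2 := by
              rw [Set.mem_uIoc] at hs
              rcases hs with hs | hs <;> nlinarith
            rw [Real.norm_eq_abs, mul_left_comm, ← Real.exp_add]
            exact le_mul_of_one_le_right (abs_nonneg _) (Real.one_le_exp (by linarith))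
      _ ≤ ∫ s, Real.exp (2 * t ^ 2) * (|g' s| * Real.exp (-(2 * s ^ 2))) :=
          setIntegral_le_integral (hi.const_mul _) (ae_of_all _ fun s => by positivity)
      _ = _ := integral_const_mul _ _
  have h3 : |g t| ≤ |g 0| + |g t - g 0| := by
    have := abs_add_le (g 0) (g t - g 0)
    simpa using this
  have h4 : |g 0| ≤ |g 0| * Real.exp (2 * t ^ 2) :=
    le_mul_of_one_le_right (abs_nonneg _) (Real.one_le_exp (by positivity))
  linarith

namespace Assumption3

variable {f : ℝ → ℝ} {Cf : ℕ} {Ct : ℝ}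

lemma continuous_iteratedDeriv (h : Assumption3 f Cf Ct) (j : ℕ) :
    Continuous (iteratedDeriv j f) :=
  h.smooth.continuous_iteratedDeriv j (by exact_mod_cast le_top)

lemma integrable_abs_iteratedDeriv_mul_exp (h : Assumption3 f Cf Ct) {n : ℕ} (hn : 1 ≤ n) :
    Integrable (fun t => |iteratedDeriv n f t| * Real.exp (-(2 * t ^ 2))) := by
  have hCt := h.Ct_pos
  have hi := h.bound_int 0 n hn (2 * Real.sqrt 2) (by simp)
  have h2 : Real.sqrt 2 ≠ 0 := by positivity
  have hx : ∀ x : ℝ, (0 + Real.sqrt 2 * x) / (2 * Real.sqrt 2) = (1 / 2) * x := fun x => by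
    field_simp
    ring
  simp only [hx] at hi
  have hcd := h.continuous_iteratedDeriv n
  rw [← integrable_comp_mul_left_iff _ (R := (1 / 2 : ℝ)) (by norm_num)]
  refine ((hi.const_mul (Ct ^ n * (Nat.factorial n : ℝ) * Real.sqrt (2 * Real.pi))).add
    ((integrable_exp_neg_sq_div (b := 2) two_pos).const_mul
      (Ct ^ n * (Nat.factorial n : ℝ)))).mono' (by fun_prop) (ae_of_all _ fun x => ?_)
  have hs : 0 ≤ derivSumF f Ct n (1 / 2 * x) := derivSumF_nonneg hCt n _
  have hpow : derivSumF f Ct n (1 / 2 * x) ≤ derivSumF f Ct n (1 / 2 * x) ^ n + 1 := by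
    rcases le_total (derivSumF f Ct n (1 / 2 * x)) 1 with h1 | h1
    · linarith [pow_nonneg hs n]
    · linarith [le_self_pow₀ h1 (by omega : n ≠ 0)]
  have hle := (abs_iteratedDeriv_le_mul_derivSumF f hCt hn le_rfl (1 / 2 * x)).trans
    (mul_le_mul_of_nonneg_left hpow (by positivity))
  have hsq : Real.sqrt (2 * Real.pi) ≠ 0 := by positivity
  rw [Real.norm_of_nonneg (by positivity)]
  calc _ ≤ Ct ^ n * (Nat.factorial n : ℝ) * (derivSumF f Ct n (1 / 2 * x) ^ n + 1) *
        Real.exp (-(2 * (1 / 2 * x) ^ 2)) := mul_le_mul_of_nonneg_right hle (Real.exp_pos _).le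
    _ = _ := by
        rw [show -(2 * (1 / 2 * x) ^ 2) = -x ^ 2 / 2 by ring]
        simp only [Pi.add_apply]
        field_simp

lemma exists_derivSumF_le (h : Assumption3 f Cf Ct) (n : ℕ) :
    ∃ K, ∀ t, derivSumF f Ct n t ≤ K * Real.exp (2 * t ^ 2) := by
  have hCt := h.Ct_pos
  have hj : ∀ j, ∃ K, ∀ t, |iteratedDeriv j f t| ≤ K * Real.exp (2 * t ^ 2) := fun j =>
    exists_abs_le_mul_exp_of_integrable (hasDerivAt_iteratedDeriv h.smooth j)
      (h.continuous_iteratedDeriv (j + 1)) (h.integrable_abs_iteratedDeriv_mul_exp (by omega))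
  choose K hK using hj
  refine ⟨∑ j ∈ Finset.Icc 1 n, K j / (Ct ^ j * (Nat.factorial j : ℝ)), fun t => ?_⟩
  rw [Finset.sum_mul]
  refine Finset.sum_le_sum fun j _ => ?_
  rw [div_mul_eq_mul_div]
  exact div_le_div_of_nonneg_right (hK j t) (by positivity)

lemma derivSumF_le_Lf (h : Assumption3 f Cf Ct) (n : ℕ) {t : ℝ} (ht : |t| ≤ 1) :
    derivSumF f Ct n t ≤ Lf f Ct n := by
  obtain ⟨K, hK⟩ := (isCompact_Icc (a := (-1 : ℝ)) (b := 1)).exists_bound_of_continuousOn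
    (continuous_derivSumF h.smooth Ct n).continuousOn
  exact le_biSup_of_forall_le (S := {x : ℝ | |x| ≤ 1}) (K := K)
    (fun x hx => (le_abs_self _).trans (hK x (abs_le.mp hx))) ht

lemma derivSumF_le_Ltf (h : Assumption3 f Cf Ct) {n : ℕ} (hn : 1 ≤ n) {τ : ℝ}
    (hτ : 16 * (n : ℝ) ≤ τ ^ 2) {t : ℝ} (ht : 1 ≤ |t|) :
    derivSumF f Ct n t ≤ Ltf f Ct n τ * Real.exp (τ ^ 2 * t ^ 2 / (8 * (n : ℝ))) := by
  have hn' : (0 : ℝ) < n := by exact_mod_cast hn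
  obtain ⟨K, hK⟩ := h.exists_derivSumF_le n
  have hb : ∀ x ∈ {x : ℝ | 1 ≤ |x|},
      derivSumF f Ct n x * Real.exp (-(τ ^ 2 * x ^ 2) / (8 * (n : ℝ))) ≤ K := by
    intro x _
    have hexp : 2 * x ^ 2 ≤ τ ^ 2 * x ^ 2 / (8 * (n : ℝ)) := by
      rw [le_div_iff₀ (by positivity)]
      nlinarith [mul_le_mul_of_nonneg_right hτ (sq_nonneg x)]
    have hK0 : 0 ≤ K := by
      have := (derivSumF_nonneg h.Ct_pos n 0).trans (hK 0)
      simpa using this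
    calc _ ≤ K * Real.exp (2 * x ^ 2) * Real.exp (-(τ ^ 2 * x ^ 2) / (8 * (n : ℝ))) :=
          mul_le_mul_of_nonneg_right (hK x) (Real.exp_pos _).le
      _ = K * Real.exp (2 * x ^ 2 + -(τ ^ 2 * x ^ 2) / (8 * (n : ℝ))) := by
          rw [Real.exp_add, mul_assoc]
      _ ≤ K := by
          refine mul_le_of_le_one_right hK0 (Real.exp_le_one_iff.mpr ?_)
          rw [neg_div]
          linarith
  have hle : derivSumF f Ct n t * Real.exp (-(τ ^ 2 * t ^ 2) / (8 * (n : ℝ))) ≤ Ltf f Ct n τ :=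
    le_biSup_of_forall_le hb ht
  calc _ = derivSumF f Ct n t * Real.exp (-(τ ^ 2 * t ^ 2) / (8 * (n : ℝ))) *
        Real.exp (τ ^ 2 * t ^ 2 / (8 * (n : ℝ))) := by
        rw [mul_assoc, ← Real.exp_add, neg_div, neg_add_cancel, Real.exp_zero, mul_one]
    _ ≤ _ := mul_le_mul_of_nonneg_right hle (Real.exp_pos _).le

lemma linkBound (h : Assumption3 f Cf Ct) {τ : ℝ} {N : ℕ} (hτ : 0 < τ) (hN : 1 ≤ N)
    (hτN : 32 * (N : ℝ) ≤ τ ^ 2)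
    (hscale : 100 * ((N : ℝ) * (Ct * max (Lf f Ct (2 * N)) (max (Ltf f Ct (2 * N) τ) 1))) ^ 2 ≤
      τ ^ 2) :
    LinkBound f Ct τ (max (Lf f Ct (2 * N)) (max (Ltf f Ct (2 * N) τ) 1)) N where
  smooth := h.smooth
  Ct_pos := h.Ct_pos
  tau_pos := hτ
  N_pos := hN
  one_le := (le_max_right _ _).trans (le_max_right _ _)
  inner x hx := by
    refine (h.derivSumF_le_Lf (2 * N) ?_).trans (le_max_left _ _)
    rwa [abs_div, abs_of_pos hτ, div_le_one hτ]
  outer x hx := by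
    refine (h.derivSumF_le_Ltf (n := 2 * N) (τ := τ) (by omega) (by push_cast; linarith)
      (t := x / τ) ?_).trans ?_
    · rwa [abs_div, abs_of_pos hτ, one_le_div hτ]
    · rw [show τ ^ 2 * (x / τ) ^ 2 / (8 * ((2 * N : ℕ) : ℝ)) = x ^ 2 / (16 * (N : ℝ)) by
        push_cast
        field_simp
        ring]
      exact mul_le_mul_of_nonneg_right ((le_max_left _ _).trans (le_max_right _ _))
        (Real.exp_pos _).le
  scale := hscale

end Assumption3

lemma CbarF_ge (Cf : ℕ) : 795 ≤ CbarF Cf := by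
  unfold CbarF
  have he : 2 ≤ Real.exp 1 := by linarith [Real.exp_one_gt_d9]
  have h1 : (9 : ℝ) ≤ Real.pi ^ 2 := by nlinarith [Real.pi_gt_three]
  have h2 : (256 : ℝ) ≤ (2 * Real.exp 1) ^ (4 * (1 + Cf)) := by
    calc (256 : ℝ) = 4 ^ 4 := by norm_num
      _ ≤ (2 * Real.exp 1) ^ 4 := by gcongr; linarith
      _ ≤ _ := pow_le_pow_right₀ (by linarith) (by omega)
  have h3 : (1 : ℝ) ≤ Real.exp 1 ^ (4 * (1 + Cf) ^ 2) := one_le_pow₀ (by linarith)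
  calc (795 : ℝ) ≤ 32 * 9 * 256 * 1 := by norm_num
    _ ≤ _ := by gcongr

lemma exp_neg_sqrt_le (N : ℕ) (hN : 1 ≤ N) (Cf : ℕ) :
    Real.exp (-Real.sqrt N) ≤
      Real.exp (-((2 * (N : ℝ) + 1) ^ ((1 : ℝ) / (2 * (1 + (Cf : ℝ))))) / (2 * Real.exp 1)) := by
  have hN' : (1 : ℝ) ≤ N := by exact_mod_cast hN
  have he : 2 ≤ Real.exp 1 := by linarith [Real.exp_one_gt_d9]
  rw [Real.exp_le_exp, neg_div, neg_le_neg_iff, div_le_iff₀ (by positivity)]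
  calc (2 * (N : ℝ) + 1) ^ ((1 : ℝ) / (2 * (1 + (Cf : ℝ)))) ≤ (2 * (N : ℝ) + 1) ^ ((1 : ℝ) / 2) := by
        refine Real.rpow_le_rpow_of_exponent_le (by linarith) ?_
        gcongr
        linarith [(Cf.cast_nonneg : (0 : ℝ) ≤ Cf)]
    _ = Real.sqrt (2 * (N : ℝ) + 1) := (Real.sqrt_eq_rpow _).symm
    _ ≤ Real.sqrt (N * 4 ^ 2) := Real.sqrt_le_sqrt (by linarith)
    _ = Real.sqrt N * 4 := by rw [Real.sqrt_mul (by positivity), Real.sqrt_sq (by norm_num)]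
    _ ≤ _ := by gcongr; linarith

/-- Theorem 2(a): TV-deficiency bound for the Markov kernel
mapping the Gaussian source (σ = 1) to the Gaussian link target. -/
theorem link_markov_deficiency :
    ∃ C : ℝ, 0 < C ∧
      ∀ (f : ℝ → ℝ) (Cf : ℕ) (Ct : ℝ) (Θ : Set ℝ) (τ : ℝ) (N : ℕ),
        Assumption3 f Cf Ct →
        BddAbove ((fun θ : ℝ => θ^2) '' Θ) →
        0 < τ →
        CbarF Cf ≤ 2 * (N:ℝ) + 1 →
        C * max ((max Ct 1)^4 *
              (max (Lf f Ct (2*N)) (max (Ltf f Ct (2*N) τ) 1))^2 * (N:ℝ)^2)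
            (⨆ θ ∈ Θ, θ^2) ≤ τ^2 →
        ∀ θ ∈ Θ,
          (1/2) * ∫ y : ℝ,
              |(∫ x : ℝ, markovKernel 1 (linkDensity f τ) N y x * srcDensity 1 θ x)
                - linkDensity f τ y θ|
            ≤ CbarF Cf *
                Real.exp (-((2*(N:ℝ)+1) ^ ((1:ℝ)/(2*(1+(Cf:ℝ))))) / (2 * Real.exp 1))
              + 12 * Real.exp (-τ/8)
              + 15 * (⨆ θ' ∈ Θ, Real.exp (θ'^2/2 - τ^2/8)) := by
  refine ⟨100, by norm_num, fun f Cf Ct Θ τ N h hΘ hτ hC hscale θ hθ => ?_⟩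
  have hCge := CbarF_ge Cf
  have hN : 1 ≤ N := by
    rw [Nat.one_le_iff_ne_zero]
    rintro rfl
    norm_num at hC
    linarith
  have hN' : (1 : ℝ) ≤ N := by exact_mod_cast hN
  set Λ := max (Lf f Ct (2 * N)) (max (Ltf f Ct (2 * N) τ) 1) with hΛdef
  have hΛ : 1 ≤ Λ := (le_max_right _ _).trans (le_max_right _ _)
  have hm : 1 ≤ max Ct 1 := le_max_right _ _
  have hm4 : (max Ct 1) ^ 2 ≤ (max Ct 1) ^ 4 := pow_le_pow_right₀ hm (by norm_num)
  have hCt2 : Ct ^ 2 ≤ (max Ct 1) ^ 2 := pow_le_pow_left₀ h.Ct_pos.le (le_max_left _ _) 2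
  have hs1 : 100 * ((max Ct 1) ^ 4 * Λ ^ 2 * (N : ℝ) ^ 2) ≤ τ ^ 2 :=
    (mul_le_mul_of_nonneg_left (le_max_left _ _) (by norm_num)).trans hscale
  have hs2 : 100 * (⨆ θ ∈ Θ, θ ^ 2) ≤ τ ^ 2 :=
    (mul_le_mul_of_nonneg_left (le_max_right _ _) (by norm_num)).trans hscale
  obtain ⟨B, hB⟩ := hΘ
  have hθ2 : θ ^ 2 ≤ ⨆ θ ∈ Θ, θ ^ 2 :=
    le_biSup_of_forall_le (S := Θ) (g := fun θ => θ ^ 2)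
      (fun x hx => hB (Set.mem_image_of_mem _ hx)) hθ
  have hN2 : 100 * (N : ℝ) ^ 2 ≤ τ ^ 2 := by
    refine le_trans ?_ hs1
    refine mul_le_mul_of_nonneg_left (le_mul_of_one_le_left (by positivity) ?_) (by norm_num)
    exact one_le_mul_of_one_le_of_one_le (one_le_pow₀ hm) (one_le_pow₀ hΛ)
  have hsc : 100 * ((N : ℝ) * (Ct * Λ)) ^ 2 ≤ τ ^ 2 := by
    refine le_trans ?_ hs1
    calc 100 * ((N : ℝ) * (Ct * Λ)) ^ 2 = 100 * (Ct ^ 2 * Λ ^ 2 * (N : ℝ) ^ 2) := by ring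
      _ ≤ _ := by gcongr; exact hCt2.trans hm4
  have hL := h.linkBound hτ hN (by nlinarith) hsc
  have hmain := hL.deficiency_le hN2 (θ := θ) (by nlinarith [sq_nonneg θ])
  have hexp := exp_neg_sqrt_le N hN Cf
  have hsup : 0 ≤ ⨆ θ' ∈ Θ, Real.exp (θ' ^ 2 / 2 - τ ^ 2 / 8) :=
    Real.iSup_nonneg fun _ => Real.iSup_nonneg fun _ => (Real.exp_pos _).le
  have h12 := Real.exp_pos (-τ / 8)
  have hfin := mul_le_mul hCge hexp (Real.exp_pos _).le (by linarith)
  linarith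
end

section
/- Let f : ℝ → ℝ be infinitely differentiable, let τ > 0, and let v(y;x) = (1/√(2π))·exp(−(y − f(x/τ))²/2). Then for every x ∈ ℝ and every integer n ≥ 1, the function y ↦ ∂_x^{n} v(y;x) is integrable on ℝ and ∫_ℝ ∂_x^{n} v(y;x) dy = 0. -/
open MeasureTheory Real Filter

open Polynomial in
/-- The product of a polynomial with the unnormalized standard Gaussian. -/
noncomputable def polyGaussian (p : ℝ[X]) (z : ℝ) : ℝ :=
  p.eval z * Real.exp (-z ^ 2 / 2)

namespace polyGaussian

open Polynomial

lemma integrable (p : ℝ[X]) : Integrable (polyGaussian p) := by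
  induction p using Polynomial.induction_on' with
  | add p q hp hq =>
    refine (hp.add hq).congr (.of_forall fun z => ?_)
    simp [polyGaussian, add_mul]
  | monomial k c =>
    have hk : (-1 : ℝ) < k := by linarith [k.cast_nonneg (α := ℝ)]
    refine ((integrable_rpow_mul_exp_neg_mul_sq (b := 1 / 2) (by norm_num) hk).const_mul
      c).congr (.of_forall fun z => ?_)
    simp only [polyGaussian, eval_monomial, Real.rpow_natCast]
    ring_nf

lemma hasDerivAt (p : ℝ[X]) (z : ℝ) :
    HasDerivAt (polyGaussian p) (polyGaussian (derivative p - X * p) z) z := by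
  have h : HasDerivAt (fun z : ℝ => -z ^ 2 / 2) (-z) z :=
    ((hasDerivAt_pow 2 z).neg.div_const 2).congr_deriv (by norm_num; ring)
  refine ((p.hasDerivAt z).mul h.exp).congr_deriv ?_
  simp only [polyGaussian, eval_sub, eval_mul, eval_X]
  ring

lemma contDiff (p : ℝ[X]) : ContDiff ℝ (⊤ : ℕ∞) (polyGaussian p) := by
  have hp : ContDiff ℝ (⊤ : ℕ∞) (fun z => p.eval z) := by
    simpa using p.contDiff_aeval (𝕜 := ℝ) (⊤ : ℕ∞)
  exact hp.mul ((contDiff_id.pow 2).neg.div_const 2).exp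

lemma integral_derivative_sub_X_mul (p : ℝ[X]) :
    ∫ z, polyGaussian (derivative p - X * p) z = 0 :=
  integral_eq_zero_of_hasDerivAt_of_integrable (hasDerivAt p) (integrable _) (integrable p)

/-- Repeatedly differentiating a weighted shifted mean-zero `polyGaussian` in the shift parameter
keeps it integrable with mean zero. -/
lemma integrable_iteratedDeriv_shift_and_integral_eq_zero {g : ℝ → ℝ}
    (hg : ContDiff ℝ (⊤ : ℕ∞) g) (x : ℝ) (n : ℕ) {a : ℝ → ℝ} (ha : ContDiff ℝ (⊤ : ℕ∞) a)
    {p : ℝ[X]} (hp : ∫ z, polyGaussian p z = 0) :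
    Integrable (fun y => iteratedDeriv n (fun t => a t * polyGaussian p (y - g t)) x) ∧
      ∫ y, iteratedDeriv n (fun t => a t * polyGaussian p (y - g t)) x = 0 := by
  induction n generalizing a p with
  | zero =>
    simp only [iteratedDeriv_zero]
    refine ⟨((integrable p).comp_sub_right (g x)).const_mul _, ?_⟩
    rw [integral_const_mul, integral_sub_right_eq_self (polyGaussian p), hp, mul_zero]
  | succ n ih =>
    have hda : ContDiff ℝ (⊤ : ℕ∞) (deriv a) := (contDiff_infty_iff_deriv.1 ha).2
    have hdg : ContDiff ℝ (⊤ : ℕ∞) (deriv g) := (contDiff_infty_iff_deriv.1 hg).2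
    have hb : ContDiff ℝ (⊤ : ℕ∞) (fun t => -(a t * deriv g t)) := (ha.mul hdg).neg
    obtain ⟨hi₁, h₁⟩ := ih hda hp
    obtain ⟨hi₂, h₂⟩ := ih hb (integral_derivative_sub_X_mul p)
    have hsmooth (q : ℝ[X]) {b : ℝ → ℝ} (hb : ContDiff ℝ (⊤ : ℕ∞) b) (y : ℝ) :
        ContDiffAt ℝ n (fun t => b t * polyGaussian q (y - g t)) x :=
      ((hb.mul ((contDiff q).comp (contDiff_const.sub hg))).of_le
        (by exact_mod_cast le_top)).contDiffAt
    have key (y : ℝ) : iteratedDeriv (n + 1) (fun t => a t * polyGaussian p (y - g t)) x =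
        iteratedDeriv n (fun t => deriv a t * polyGaussian p (y - g t)) x +
          iteratedDeriv n (fun t => -(a t * deriv g t) *
            polyGaussian (derivative p - X * p) (y - g t)) x := by
      rw [iteratedDeriv_succ', ← iteratedDeriv_fun_add (hsmooth p hda y) (hsmooth _ hb y)]
      congr 1
      funext t
      have hat := (ha.differentiable (by simp) t).hasDerivAt
      have hgt := (hg.differentiable (by simp) t).hasDerivAt
      refine (hat.mul ((hasDerivAt p (y - g t)).comp t (hgt.const_sub y))).deriv.trans ?_
      simp only [Function.comp_apply]
      ring
    simp only [key]
    exact ⟨hi₁.add hi₂, by rw [integral_add hi₁ hi₂, h₁, h₂, add_zero]⟩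

end polyGaussian

/-- Lemma 7(c): for the Gaussian link target, every partial
derivative in the parameter of order `n ≥ 1` is integrable in `y` with zero
integral. -/
theorem link_derivative_zero_integral
    (f : ℝ → ℝ) (hf : ContDiff ℝ (⊤ : ℕ∞) f) (τ : ℝ) (hτ : 0 < τ) :
    ∀ (x : ℝ) (n : ℕ), 1 ≤ n →
      Integrable (fun y : ℝ => iteratedDeriv n (fun t => linkDensity f τ y t) x) ∧
      ∫ y : ℝ, iteratedDeriv n (fun t => linkDensity f τ y t) x = 0 := by
  intro x n hn
  obtain ⟨m, rfl⟩ := Nat.exists_eq_add_of_le' hn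
  have hg : ContDiff ℝ (⊤ : ℕ∞) (fun t => f (t / τ)) := hf.comp (contDiff_id.div_const τ)
  have hdg : ContDiff ℝ (⊤ : ℕ∞) (deriv fun t => f (t / τ)) := (contDiff_infty_iff_deriv.1 hg).2
  have key (y : ℝ) : deriv (fun t => linkDensity f τ y t) = fun t =>
      -(1 / √(2 * π) * deriv (fun t => f (t / τ)) t) *
        polyGaussian (Polynomial.derivative 1 - Polynomial.X * 1) (y - f (t / τ)) := by
    funext t
    have hgt := (hg.differentiable (by simp) t).hasDerivAt
    have h := ((polyGaussian.hasDerivAt 1 (y - f (t / τ))).comp t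
      (hgt.const_sub y)).const_mul (1 / √(2 * π))
    rw [show (fun t => linkDensity f τ y t) = fun t =>
      1 / √(2 * π) * (polyGaussian 1 ∘ fun t => y - f (t / τ)) t by
        funext t; simp [linkDensity, polyGaussian], h.deriv]
    ring
  simp only [iteratedDeriv_succ', key]
  exact polyGaussian.integrable_iteratedDeriv_shift_and_integral_eq_zero hg x m
    (contDiff_const.mul hdg).neg (polyGaussian.integral_derivative_sub_X_mul 1)
end
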